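/- Let f(x) = (x² − x − 1)⁵·(x² − x − 1/16) − t·x³·(x − 1)³·(x³ − 2), a polynomial of degree 12 in x with coefficients in ℚ(t). Then the Galois group of (the splitting field of) f over ℚ(t) is a simple group of cardinality 7920 (i.e., it is isomorphic to the Mathieu group M₁₁). -/

import Mathlib

open Polynomial


/-- The generator `t` of the rational function field `ℚ(t)`. -/
noncomputable def t : RatFunc ℚ := RatFunc.X

/-- `f(x) = (x² − x − 1)⁵ (x² − x − 1/16) − t · x³ (x − 1)³ (x³ − 2)` over `ℚ(t)`. -/
noncomputable def f : Polynomial (RatFunc ℚ) :=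
  (X ^ 2 - X - 1) ^ 5 * (X ^ 2 - X - C (1 / 16 : RatFunc ℚ)) -
    C t * (X ^ 3 * (X - 1) ^ 3 * (X ^ 3 - 2))


/-- side table -/
def sd : Fin 11 → Fin 12 → Bool :=
  ![![true,true,false,false,false,false,true,true,true,false,true,false],
    ![true,true,false,true,true,false,false,true,false,true,false,false],
    ![true,true,true,false,false,true,false,false,false,true,true,false],
    ![true,false,false,true,true,true,false,false,true,false,true,false],
    ![true,false,true,true,false,true,true,true,false,false,false,false],
    ![true,false,true,false,true,false,false,true,false,false,true,true],
    ![true,true,true,true,false,false,false,false,true,false,false,true],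
    ![true,false,true,false,true,false,true,false,true,true,false,false],
    ![true,false,false,true,false,false,true,false,false,true,true,true],
    ![true,false,false,false,false,true,false,true,true,true,false,true],
    ![true,true,false,false,true,true,true,false,false,false,false,true]]

/-- two points on the same side of block `b` -/
def sm (b : Fin 11) (i j : Fin 12) : Bool := sd b i == sd b j

def MM : Subgroup (Equiv.Perm (Fin 12) × Equiv.Perm (Fin 11)) where
  carrier := {g | ∀ b i j, sm (g.2 b) (g.1 i) (g.1 j) = sm b i j}
  mul_mem' := by
    intro x y hx hy b i j
    simp only [Prod.fst_mul, Prod.snd_mul, Equiv.Perm.mul_apply]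
    rw [hx, hy]
  one_mem' := by intro b i j; rfl
  inv_mem' := by
    intro x hx b i j
    have := hx (x.2⁻¹ b) (x.1⁻¹ i) (x.1⁻¹ j)
    simpa using this.symm

lemma mem_MM (g : Equiv.Perm (Fin 12) × Equiv.Perm (Fin 11)) :
    g ∈ MM ↔ ∀ b i j, sm (g.2 b) (g.1 i) (g.1 j) = sm b i j := Iff.rfl

def rl (l : List (Fin 12)) (n x0 x : Fin 12) : Bool :=
  (sm 0 x0 x == sm 0 0 n) && (sm 1 x0 x == sm 1 0 n) && (sm 2 x0 x == sm 2 0 n)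
    && (sm 3 x0 x == sm 3 0 n) && l.all (fun y => x != y)

set_option maxRecDepth 100000 in
set_option synthInstance.maxSize 10000 in
set_option synthInstance.maxHeartbeats 200000 in
lemma key_dec : ∀ x0 x1 : Fin 12, rl [x0] 1 x0 x1 = true →
    ∀ x2, rl [x0, x1] 2 x0 x2 = true →
    ∀ x3, rl [x0, x1, x2] 3 x0 x3 = true →
    ∀ x4, rl [x0, x1, x2, x3] 4 x0 x4 = true →
    ∀ x5, rl [x0, x1, x2, x3, x4] 5 x0 x5 = true →
    ∀ x6, rl [x0, x1, x2, x3, x4, x5] 6 x0 x6 = true →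
    ∀ x7, rl [x0, x1, x2, x3, x4, x5, x6] 7 x0 x7 = true →
    ∀ x8, rl [x0, x1, x2, x3, x4, x5, x6, x7] 8 x0 x8 = true →
    ∀ x9, rl [x0, x1, x2, x3, x4, x5, x6, x7, x8] 9 x0 x9 = true →
    ∀ x10, rl [x0, x1, x2, x3, x4, x5, x6, x7, x8, x9] 10 x0 x10 = true →
    ∀ x11, rl [x0, x1, x2, x3, x4, x5, x6, x7, x8, x9, x10] 11 x0 x11 = true →
    (∃ b' : Fin 11, [x0, x1, x2, x3, x4, x5, x6, x7, x8, x9, x10, x11].map (sm b' x0) =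
      [0, 1, 2, 3, 4, 5, 6, 7, 8, 9, 10, 11].map (sm 4 0)) →
    [x0, x1, x2, x3, x4, x5, x6, x7, x8, x9, x10, x11] = [0, 1, 2, 3, 4, 5, 6, 7, 8, 9, 10, 11] := by
  decide +kernel

lemma sm_inj : ∀ b b' : Fin 11, (∀ i, sm b 0 i = sm b' 0 i) → b = b' := by decide +kernel

lemma MM_fix (g : Equiv.Perm (Fin 12) × Equiv.Perm (Fin 11)) (hg : g ∈ MM)
    (h0 : g.2 0 = 0) (h1 : g.2 1 = 1) (h2 : g.2 2 = 2) (h3 : g.2 3 = 3) : g = 1 := by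
  have hr : ∀ n, ∀ l : List (Fin 12), n ∉ l → rl (l.map g.1) n (g.1 0) (g.1 n) = true := by
    intro n l hl
    have e0 := hg 0 0 n
    have e1 := hg 1 0 n
    have e2 := hg 2 0 n
    have e3 := hg 3 0 n
    rw [h0] at e0; rw [h1] at e1; rw [h2] at e2; rw [h3] at e3
    have : ∀ x ∈ l, ¬ n = x := fun x hx h => hl (h ▸ hx)
    simpa [rl, e0, e1, e2, e3] using this
  have := key_dec (g.1 0)
    (g.1 1) (hr 1 [0] (by decide))
    (g.1 2) (hr 2 [0, 1] (by decide))
    (g.1 3) (hr 3 [0, 1, 2] (by decide))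
    (g.1 4) (hr 4 [0, 1, 2, 3] (by decide))
    (g.1 5) (hr 5 [0, 1, 2, 3, 4] (by decide))
    (g.1 6) (hr 6 [0, 1, 2, 3, 4, 5] (by decide))
    (g.1 7) (hr 7 [0, 1, 2, 3, 4, 5, 6] (by decide))
    (g.1 8) (hr 8 [0, 1, 2, 3, 4, 5, 6, 7] (by decide))
    (g.1 9) (hr 9 [0, 1, 2, 3, 4, 5, 6, 7, 8] (by decide))
    (g.1 10) (hr 10 [0, 1, 2, 3, 4, 5, 6, 7, 8, 9] (by decide))
    (g.1 11) (hr 11 [0, 1, 2, 3, 4, 5, 6, 7, 8, 9, 10] (by decide))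
    ⟨g.2 4, by simp only [List.map_cons, List.map_nil, hg 4]⟩
  simp only [List.cons.injEq, and_true] at this
  obtain ⟨i0, i1, i2, i3, i4, i5, i6, i7, i8, i9, i10, i11⟩ := this
  have hs : ∀ i, g.1 i = i := by
    intro i; fin_cases i <;> assumption
  have hp : ∀ b, g.2 b = b := by
    intro b
    apply sm_inj
    intro i
    have := hg b 0 i
    rwa [hs, hs] at this
  exact Prod.ext (Equiv.ext hs) (Equiv.ext hp)

lemma MM_card_le : Nat.card MM ≤ 7920 := by
  let F : MM → (Fin 4 ↪ Fin 11) := fun g =>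
    ⟨fun k => g.1.2 (Fin.castLE (by norm_num) k), fun i j h => by
      have := g.1.2.injective h
      simpa using this⟩
  have hF : Function.Injective F := by
    intro g h hgh
    have hk : ∀ k : Fin 4, g.1.2 (Fin.castLE (by norm_num) k) = h.1.2 (Fin.castLE (by norm_num) k) :=
      fun k => DFunLike.congr_fun hgh k
    have : (h⁻¹ * g).1 = 1 := by
      apply MM_fix _ (h⁻¹ * g).2
      · have := hk 0
        change h.1.2⁻¹ (g.1.2 0) = 0
        rw [Equiv.Perm.inv_eq_iff_eq]; exact this
      · have := hk 1
        change h.1.2⁻¹ (g.1.2 1) = 1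
        rw [Equiv.Perm.inv_eq_iff_eq]; exact this
      · have := hk 2
        change h.1.2⁻¹ (g.1.2 2) = 2
        rw [Equiv.Perm.inv_eq_iff_eq]; exact this
      · have := hk 3
        change h.1.2⁻¹ (g.1.2 3) = 3
        rw [Equiv.Perm.inv_eq_iff_eq]; exact this
    have h2 : h⁻¹ * g = 1 := Subtype.ext this
    exact (inv_mul_eq_one.mp h2).symm
  have := Nat.card_le_card_of_injective F hF
  simpa [Fintype.card_embedding_eq, Nat.descFactorial] using this

lemma step_card {G : Type*} [Group G] [Finite G] (H K : Subgroup G) (hK : K ≤ H) (s : G)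
    (hs : s ∈ H) (p : ℕ) (hp : p.Prime) (hn : s ∈ Subgroup.normalizer (K : Set G)) (hsp : s ^ p ∈ K) (hsK : s ∉ K) :
    Nat.card K * p ∣ Nat.card H := by
  let L := H ⊓ Subgroup.normalizer (K : Set G)
  have hKL : K ≤ L := le_inf hK Subgroup.le_normalizer
  let K' := K.subgroupOf L
  have : K'.Normal := Subgroup.normal_subgroupOf_of_le_normalizer inf_le_right
  have hor : orderOf ((⟨s, hs, hn⟩ : L) : L ⧸ K') = p := by
    have := Fact.mk hp
    apply orderOf_eq_prime
    · rw [← QuotientGroup.mk_pow]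
      exact (QuotientGroup.eq_one_iff _).2 (Subgroup.mem_subgroupOf.2 (by simpa using hsp))
    · intro h
      apply hsK
      have := (QuotientGroup.eq_one_iff _).1 h
      exact Subgroup.mem_subgroupOf.1 this
  have h1 : p ∣ Nat.card (L ⧸ K') := hor ▸ orderOf_dvd_natCard _
  have h2 := Subgroup.card_eq_card_quotient_mul_card_subgroup K'
  have h3 : Nat.card K' = Nat.card K := Nat.card_congr (Subgroup.subgroupOfEquivOfLe hKL).toEquiv
  have h4 : Nat.card L ∣ Nat.card H := Subgroup.card_dvd_of_le inf_le_left
  refine dvd_trans ?_ h4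
  rw [h2, h3, mul_comm]
  exact mul_dvd_mul h1 dvd_rfl

def eA : MM := ⟨(⟨![10, 5, 3, 1, 9, 4, 6, 2, 11, 0, 8, 7], ![9, 3, 7, 2, 5, 1, 6, 11, 10, 4, 0, 8],
    by decide +kernel, by decide +kernel⟩, ⟨![1, 2, 3, 4, 9, 10, 7, 8, 0, 5, 6], ![8, 0, 1, 2, 3, 9, 10, 6, 7, 4, 5],
    by decide +kernel, by decide +kernel⟩), by rw [mem_MM]; decide +kernel⟩

def eB : MM := ⟨(⟨![9, 1, 11, 10, 5, 6, 3, 0, 4, 2, 7, 8], ![7, 1, 9, 6, 8, 4, 5, 10, 11, 0, 3, 2],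
    by decide +kernel, by decide +kernel⟩, ⟨![1, 2, 3, 6, 8, 9, 4, 0, 10, 7, 5], ![7, 0, 1, 2, 6, 10, 3, 9, 4, 5, 8],
    by decide +kernel, by decide +kernel⟩), by rw [mem_MM]; decide +kernel⟩

def eD : MM := eA * eB * eB * eA
def eR : MM := eA * eB * eA * eA
def eS : MM := eA * eA * eA * eB * eA * eA * eB
def eU : MM := eA * eB
def eV : MM := eA * eA * eA * eB * eB * eB * eA * eB * eB * eA * eA

lemma ordA : orderOf eA = 11 := by
  have := Fact.mk (show Nat.Prime 11 by norm_num)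
  exact orderOf_eq_prime (by decide +kernel) (by decide +kernel)
lemma ordB : orderOf eB = 11 := by
  have := Fact.mk (show Nat.Prime 11 by norm_num)
  exact orderOf_eq_prime (by decide +kernel) (by decide +kernel)
lemma ordD : orderOf eD = 5 := by
  have := Fact.mk (show Nat.Prime 5 by norm_num)
  exact orderOf_eq_prime (by decide +kernel) (by decide +kernel)
lemma ordU : orderOf eU = 3 := by
  have := Fact.mk (show Nat.Prime 3 by norm_num)
  exact orderOf_eq_prime (by decide +kernel) (by decide +kernel)
lemma ordR : orderOf eR = 8 := by
  have := Fact.mk (show Nat.Prime 2 by norm_num)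
  exact orderOf_eq_prime_pow (p := 2) (n := 2) (by decide +kernel) (by decide +kernel)

lemma mem_zp {G : Type*} [Group G] [Finite G] (r x : G) (n : ℕ) (hr : orderOf r = n)
    (h : x ∈ Subgroup.zpowers r) : ∃ k : Fin n, r ^ (k : ℕ) = x := by
  classical
  rw [← mem_powers_iff_mem_zpowers, mem_powers_iff_mem_range_orderOf] at h
  simp only [Finset.mem_image, Finset.mem_range] at h
  obtain ⟨k, hk, rfl⟩ := h
  exact ⟨⟨k, hr ▸ hk⟩, rfl⟩

lemma norm_zp {G : Type*} [Group G] [Finite G] (r s : G) (k : ℕ) (h : s * r * s⁻¹ = r ^ k) :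
    s ∈ Subgroup.normalizer (Subgroup.zpowers r : Set G) := by
  rw [Subgroup.mem_normalizer_iff_map_conj_eq]
  apply Subgroup.eq_of_le_of_card_ge
  · rw [MonoidHom.map_zpowers, Subgroup.zpowers_le]
    change s * r * s⁻¹ ∈ _
    rw [h]
    exact Subgroup.pow_mem _ (Subgroup.mem_zpowers r) k
  · exact (Nat.card_congr (Subgroup.equivMapOfInjective _ _ (MulAut.conj s).injective).toEquiv).le

lemma lemX (H : Subgroup MM) (hA : eA ∈ H) (hB : eB ∈ H) : 7920 ∣ Nat.card H := by
  have mR : eR ∈ H := (H.mul_mem (H.mul_mem (H.mul_mem hA hB) hA) hA)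
  have mS : eS ∈ H := (H.mul_mem (H.mul_mem (H.mul_mem (H.mul_mem (H.mul_mem (H.mul_mem hA hA) hA) hB) hA) hA) hB)
  have mU : eU ∈ H := (H.mul_mem hA hB)
  have mV : eV ∈ H := (H.mul_mem (H.mul_mem (H.mul_mem (H.mul_mem (H.mul_mem (H.mul_mem (H.mul_mem (H.mul_mem (H.mul_mem (H.mul_mem hA hA) hA) hB) hB) hB) hA) hB) hB) hA) hA)
  have mD : eD ∈ H := (H.mul_mem (H.mul_mem (H.mul_mem hA hB) hB) hA)
  have h11 : 11 ∣ Nat.card H := by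
    have := H.orderOf_dvd_natCard hA
    rwa [ordA] at this
  have h5 : 5 ∣ Nat.card H := ordD ▸ H.orderOf_dvd_natCard mD
  have h16 : 8 * 2 ∣ Nat.card H := by
    have := step_card H (Subgroup.zpowers eR) (by simpa using mR) eS mS 2 (by norm_num)
      (norm_zp _ _ 3 (by decide +kernel)) (by
        have : eS ^ 2 = 1 := by decide +kernel
        rw [this]; exact one_mem _) (by
        intro h
        obtain ⟨k, hk⟩ := mem_zp _ _ 8 ordR h
        revert k
        decide +kernel)
    rwa [Nat.card_zpowers, ordR] at this
  have h9 : 3 * 3 ∣ Nat.card H := by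
    have := step_card H (Subgroup.zpowers eU) (by simpa using mU) eV mV 3 (by norm_num)
      (norm_zp _ _ 1 (by decide +kernel)) (by
        have : eV ^ 3 = 1 := by decide +kernel
        rw [this]; exact one_mem _) (by
        intro h
        obtain ⟨k, hk⟩ := mem_zp _ _ 3 ordU h
        revert k
        decide +kernel)
    rwa [Nat.card_zpowers, ordU] at this
  have := Nat.Coprime.mul_dvd_of_dvd_of_dvd (by norm_num) h11 h5
  have := Nat.Coprime.mul_dvd_of_dvd_of_dvd (by norm_num) this h16
  have := Nat.Coprime.mul_dvd_of_dvd_of_dvd (by norm_num) this h9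
  simpa using this

lemma card_MM : Nat.card MM = 7920 := by
  have h := lemX ⊤ trivial trivial
  rw [Subgroup.card_top] at h
  exact le_antisymm MM_card_le (Nat.le_of_dvd Nat.card_pos h)

lemma eq_top_MM (H : Subgroup MM) (hA : eA ∈ H) (hB : eB ∈ H) : H = ⊤ := by
  apply Subgroup.eq_top_of_le_card
  rw [card_MM]
  exact Nat.le_of_dvd Nat.card_pos (lemX H hA hB)

lemma mem_of_small {G : Type*} [Group G] [Finite G] (H : Subgroup G) (hi : H.index ≤ 10) (a : G)
    (ha : orderOf a = 11) : a ∈ H := by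
  obtain ⟨n, h0, hn, h⟩ := Subgroup.exists_pow_mem_of_index_ne_zero (H := H)
    Subgroup.index_ne_zero_of_finite a
  have hc : Nat.Coprime n (orderOf a) := by
    rw [ha]
    apply Nat.Coprime.symm
    rw [Nat.Prime.coprime_iff_not_dvd (by norm_num)]
    intro hd
    have := Nat.le_of_dvd h0 hd
    omega
  obtain ⟨m, hm⟩ := exists_pow_eq_self_of_coprime hc
  rw [← hm]
  exact H.pow_mem h m

lemma eq_top_of_dvd (H : Subgroup MM) (h : 1320 ∣ Nat.card H) : H = ⊤ := by
  have h1 := H.card_mul_index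
  rw [card_MM] at h1
  have hi : H.index ≤ 10 := by
    have := Nat.le_of_dvd Nat.card_pos h
    by_contra hc
    push Not at hc
    nlinarith
  exact eq_top_MM H (mem_of_small H hi _ ordA) (mem_of_small H hi _ ordB)

instance actMM : MulAction MM (Fin 11) :=
  MulAction.compHom (Fin 11) ((MonoidHom.snd (Equiv.Perm (Fin 12)) (Equiv.Perm (Fin 11))).comp MM.subtype)

lemma smulMM (g : MM) (b : Fin 11) : g • b = g.1.2 b := rfl

lemma simple_MM : IsSimpleGroup MM := by
  have hnt : Nontrivial MM := ⟨eA, 1, by decide +kernel⟩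
  refine ⟨fun N hN => ?_⟩
  by_cases hb : N = ⊥
  · exact Or.inl hb
  right
  have htr : MulAction.IsPretransitive MM (Fin 11) := by
    have h0 : ∀ b : Fin 11, ∃ k : Fin 11, (eA ^ (k : ℕ)) • (0 : Fin 11) = b := by decide +kernel
    refine ⟨fun x y => ?_⟩
    obtain ⟨k, hk⟩ := h0 x
    obtain ⟨l, hl⟩ := h0 y
    exact ⟨eA ^ (l : ℕ) * (eA ^ (k : ℕ))⁻¹, by rw [← hk, ← hl, smul_smul]; group⟩
  have hpp : MulAction.IsPreprimitive MM (Fin 11) :=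
    MulAction.IsPreprimitive.of_prime_card (by rw [Nat.card_fin]; norm_num)
  have hNt : MulAction.IsPretransitive N (Fin 11) := by
    apply MulAction.IsQuasiPreprimitive.isPretransitive_of_normal (G := MM)
    intro hf
    apply hb
    rw [eq_bot_iff]
    intro g hg
    have hfix : ∀ b : Fin 11, g.1.2 b = b := by
      intro b
      have : b ∈ MulAction.fixedPoints N (Fin 11) := hf ▸ trivial
      exact this ⟨g, hg⟩
    exact Subtype.ext (MM_fix g.1 g.2 (hfix 0) (hfix 1) (hfix 2) (hfix 3))
  have h11 : 11 ∣ Nat.card N := by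
    have := (MulAction.stabilizer N (0 : Fin 11)).index_dvd_card
    rwa [MulAction.index_stabilizer_of_transitive, Nat.card_fin] at this
  have hin : ∀ a : MM, orderOf a = 11 → a ∈ N := by
    intro a ha
    rw [← QuotientGroup.eq_one_iff, ← orderOf_eq_one_iff]
    have d1 : orderOf (a : MM ⧸ N) ∣ 11 := by
      have := orderOf_map_dvd (QuotientGroup.mk' N) a
      rwa [ha] at this
    have d2 : orderOf (a : MM ⧸ N) ∣ Nat.card (MM ⧸ N) := orderOf_dvd_natCard _
    rcases (Nat.dvd_prime (by norm_num)).1 d1 with h | h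
    · exact h
    · exfalso
      rw [h] at d2
      have := mul_dvd_mul d2 h11
      rw [← Subgroup.card_eq_card_quotient_mul_card_subgroup, card_MM] at this
      revert this; decide
  exact eq_top_MM N (hin _ ordA) (hin _ ordB)

def lev {R : Type*} [CommRing R] (α : R) : List ℕ → R
  | [] => 0
  | c :: l => (c : R) + α * lev α l

def ladd (p : ℕ) : List ℕ → List ℕ → List ℕ
  | [], b => b
  | a, [] => a
  | x :: a, y :: b => (x + y) % p :: ladd p a b

def lsm (p c : ℕ) : List ℕ → List ℕ
  | [] => []
  | y :: b => (c * y) % p :: lsm p c b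

def lxm (p : ℕ) (red : List ℕ) (a : List ℕ) : List ℕ :=
  if a.length = 12 then ladd p (0 :: a.dropLast) (lsm p (a.getLastD 0) red) else 0 :: a

def lmul (p : ℕ) (red : List ℕ) : List ℕ → List ℕ → List ℕ
  | [], _ => []
  | c :: l, b => ladd p (lsm p c b) (lxm p red (lmul p red l b))

def lpow (p : ℕ) (red : List ℕ) (g : List ℕ) : ℕ → List ℕ
  | 0 => [1]
  | n + 1 => lmul p red (lpow p red g n) g

def lfr (p : ℕ) (red : List ℕ) : ℕ → List ℕ
  | 0 => [0, 1]
  | n + 1 => lpow p red (lfr p red n) p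

section
variable {R : Type*} [CommRing R] (p : ℕ) (hp : (p : R) = 0) (α : R) (red : List ℕ)
  (hred : α ^ 12 = lev α red)
include hp

lemma cast_mod' (x : ℕ) : ((x % p : ℕ) : R) = x := by
  conv_rhs => rw [← Nat.mod_add_div x p]
  push_cast
  rw [hp]; ring

lemma lev_ladd (a b : List ℕ) : lev α (ladd p a b) = lev α a + lev α b := by
  fun_induction ladd p a b with
  | case1 b => simp [lev]
  | case2 a => simp [lev]
  | case3 x a y b ih => simp only [lev, cast_mod' p hp, ih]; push_cast; ring

lemma lev_lsm (c : ℕ) (b : List ℕ) : lev α (lsm p c b) = c * lev α b := by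
  induction b with
  | nil => simp [lev, lsm]
  | cons y b ih => simp only [lev, lsm, cast_mod' p hp, ih]; push_cast; ring

omit hp in
lemma lev_append (a b : List ℕ) : lev α (a ++ b) = lev α a + α ^ a.length * lev α b := by
  induction a with
  | nil => simp [lev]
  | cons y a ih => simp only [List.cons_append, lev, ih, List.length_cons]; ring

include hred in
lemma lev_lxm (a : List ℕ) : lev α (lxm p red a) = α * lev α a := by
  unfold lxm
  split_ifs with h
  · rw [lev_ladd p hp, lev_lsm p hp, ← hred]
    have hne : a ≠ [] := by rintro rfl; simp at h
    conv_rhs => rw [← List.dropLast_append_getLast hne]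
    rw [lev_append, List.length_dropLast, h, List.getLastD_eq_getLast?, List.getLast?_eq_getLast_of_ne_nil hne]
    simp only [lev, Option.getD_some]
    push_cast
    ring
  · simp [lev]

include hred in
lemma lev_lmul (a b : List ℕ) : lev α (lmul p red a b) = lev α a * lev α b := by
  induction a with
  | nil => simp [lev, lmul]
  | cons c l ih => simp only [lmul, lev, lev_ladd p hp, lev_lsm p hp, lev_lxm p hp α red hred, ih]; ring

include hred in
lemma lev_lpow (g : List ℕ) (n : ℕ) : lev α (lpow p red g n) = lev α g ^ n := by
  induction n with
  | zero => simp [lev, lpow]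
  | succ n ih => rw [lpow, lev_lmul p hp α red hred, ih, pow_succ]

include hred in
lemma lev_lfr (n : ℕ) : lev α (lfr p red n) = α ^ p ^ n := by
  induction n with
  | zero => simp [lev, lfr]
  | succ n ih => rw [lfr, lev_lpow p hp α red hred, ih, ← pow_mul, pow_succ]
end

lemma lift_roots {A L : Type*} [CommRing A] [Field L] [Algebra A L] (F : A[X]) (hF : F.Monic)
    (hs : (F.map (algebraMap A L)).Splits) :
    ∃ rs : Multiset (integralClosure A L),
      F.map (algebraMap A (integralClosure A L)) = (rs.map (fun r => X - C r)).prod ∧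
      ∀ z : L, (F.map (algebraMap A L)).IsRoot z → ∃ r ∈ rs, (r : L) = z := by
  set FL := F.map (algebraMap A L) with hFL
  have hm : FL.Monic := hF.map _
  have hint : ∀ z ∈ FL.roots, IsIntegral A z := by
    intro z hz
    have := (mem_roots hm.ne_zero).1 hz
    exact ⟨F, hF, by rwa [hFL, IsRoot, eval_map] at this⟩
  refine ⟨FL.roots.attach.map (fun z => ⟨z.1, hint z.1 z.2⟩), ?_, ?_⟩
  · apply Polynomial.map_injective (algebraMap (integralClosure A L) L)
      (FaithfulSMul.algebraMap_injective _ _)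
    rw [Polynomial.map_map, ← IsScalarTower.algebraMap_eq, ← hFL, Polynomial.map_multiset_prod,
      Multiset.map_map, Multiset.map_map]
    conv_lhs => rw [hs.eq_prod_roots_of_monic hm, ← Multiset.attach_map_val FL.roots,
      Multiset.map_map]
    congr 1
    apply Multiset.map_congr
    · simp
    · intro z hz
      simp
  · intro z hz
    have h : z ∈ FL.roots := (mem_roots hm.ne_zero).2 hz
    exact ⟨⟨z, hint z h⟩, Multiset.mem_map.2 ⟨⟨z, h⟩, by simp, rfl⟩, rfl⟩

lemma frob_abs {A K L : Type*} [CommRing A] [IsDomain A] [IsIntegrallyClosed A]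
    [IsNoetherianRing A] [Field K] [CharZero K] [Algebra A K] [IsFractionRing A K]
    [Field L] [Algebra K L] [Algebra A L] [IsScalarTower A K L] [FiniteDimensional K L]
    [IsGalois K L] (F : A[X]) (hF : F.Monic) (hs : (F.map (algebraMap A L)).Splits)
    (p : ℕ) [Fact p.Prime] (ev : A →+* ZMod p) (hev : Function.Surjective ev) (n m : ℕ) (hn : n ≠ 0)
    (h1 : F.map ev ∣ X ^ p ^ n - X) (h2 : ¬ F.map ev ∣ X ^ p ^ m - X) :
    ∃ σ : Gal(L/K), (∀ z : L, (F.map (algebraMap A L)).IsRoot z → (σ ^ n) z = z) ∧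
      σ ^ m ≠ 1 := by
  obtain ⟨rs, hrs, hroot⟩ := lift_roots F hF hs
  let S := integralClosure A L
  let _ : MulSemiringAction Gal(L/K) S := IsIntegralClosure.MulSemiringAction A K L S
  have hfr : IsFractionRing S L := IsIntegralClosure.isFractionRing_of_finite_extension A K L S
  have hinv : Algebra.IsInvariant A S Gal(L/K) := Algebra.isInvariant_of_isGalois A K L S
  have hfin : Module.Finite A S := IsIntegralClosure.finite A K L S
  have hsm : ∀ (g : Gal(L/K)) (s : S), ((g • s : S) : L) = g (s : L) := fun g s =>
    algebraMap_galRestrict_apply A g s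
  have : FaithfulSMul A L := by
    rw [faithfulSMul_iff_algebraMap_injective, IsScalarTower.algebraMap_eq A K L]
    exact (algebraMap K L).injective.comp (IsFractionRing.injective A K)
  let P : Ideal A := RingHom.ker ev
  have hPm : P.IsMaximal := RingHom.ker_isMaximal_of_surjective ev hev
  obtain ⟨Q, hQm, hQP⟩ := Ideal.exists_maximal_ideal_liesOver_of_isIntegral P (S := S)
  have hunder : Q.under A = P := hQP.over.symm
  let e : A ⧸ P ≃+* ZMod p := RingHom.quotientKerEquivOfSurjective hev
  have hcard : Nat.card (A ⧸ Q.under A) = p := by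
    rw [hunder, Nat.card_congr e.toEquiv, Nat.card_zmod]
  have hfA : Finite (A ⧸ P) := Finite.of_equiv _ e.symm.toEquiv
  have hfS : Finite (S ⧸ Q) := by
    have : Module.Finite (A ⧸ P) (S ⧸ Q) := inferInstance
    exact Module.finite_of_finite (A ⧸ P)
  have : SMulCommClass Gal(L/K) A S := by
    refine ⟨fun g a s => Subtype.ext ?_⟩
    have h1 : ((a • s : S) : L) = algebraMap K L (algebraMap A K a) * (s : L) := by
      rw [← IsScalarTower.algebraMap_apply, ← Algebra.smul_def]; rfl
    have h2 : ((a • (g • s) : S) : L) = algebraMap K L (algebraMap A K a) * ((g • s : S) : L) := by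
      rw [← IsScalarTower.algebraMap_apply, ← Algebra.smul_def]; rfl
    rw [h2, hsm, hsm, h1, map_mul, AlgEquiv.commutes]
  obtain ⟨σ, hσ⟩ := IsArithFrobAt.exists_of_isInvariant A Gal(L/K) Q
  have hσ' : ∀ x : S, Ideal.Quotient.mk Q (σ • x) = (Ideal.Quotient.mk Q x) ^ p := by
    intro x
    have := hσ.mk_apply x
    rwa [hcard] at this
  have hσk : ∀ (k : ℕ) (x : S), Ideal.Quotient.mk Q (σ ^ k • x) = (Ideal.Quotient.mk Q x) ^ p ^ k := by
    intro k x
    induction k with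
    | zero => simp
    | succ k ih => rw [pow_succ', mul_smul, hσ', ih, ← pow_mul, pow_succ]
  -- the residue map
  let j : ZMod p →+* S ⧸ Q := (algebraMap (A ⧸ P) (S ⧸ Q)).comp e.symm.toRingHom
  have hj : j.comp ev = (Ideal.Quotient.mk Q).comp (algebraMap A S) := by
    ext a
    have : e.symm (ev a) = Ideal.Quotient.mk P a := by
      rw [RingEquiv.symm_apply_eq]
      exact (RingHom.quotientKerEquivOfSurjective_apply_mk hev a).symm
    change algebraMap (A ⧸ P) (S ⧸ Q) (e.symm (ev a)) = _
    rw [this]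
    rfl
  let mk := Ideal.Quotient.mk Q
  have hdom : IsDomain (S ⧸ Q) := Ideal.Quotient.isDomain Q
  have hprod : (F.map ev).map j = ((rs.map mk).map (fun r => X - C r)).prod := by
    rw [Polynomial.map_map, hj, ← Polynomial.map_map, hrs, Polynomial.map_multiset_prod,
      Multiset.map_map, Multiset.map_map]
    congr 1
    apply Multiset.map_congr rfl
    intro r _
    simp [mk]
  have hroots : ((F.map ev).map j).roots = rs.map mk := by
    rw [hprod, roots_multiset_prod_X_sub_C]
  have hp1 : 1 < p := (Fact.out : p.Prime).one_lt
  have hsep : (F.map ev).Separable :=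
    (galois_poly_separable p (p ^ n) (dvd_pow_self p hn)).of_dvd h1
  have hnd : (rs.map mk).Nodup := by
    rw [← hroots]
    exact nodup_roots hsep.map
  have hinj : ∀ r ∈ rs, ∀ r' ∈ rs, mk r = mk r' → r = r' := 
    Multiset.inj_on_of_nodup_map hnd
  have hmem : ∀ r : S, (F.map (algebraMap A L)).IsRoot (r : L) → r ∈ rs := by
    intro r hr
    obtain ⟨r', h, h'⟩ := hroot _ hr
    rwa [Subtype.ext h'] at h
  have hst : ∀ (g : Gal(L/K)) (r : S), (F.map (algebraMap A L)).IsRoot (r : L) →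
      (F.map (algebraMap A L)).IsRoot ((g • r : S) : L) := by
    intro g r hr
    rw [IsRoot, eval_map_algebraMap] at hr ⊢
    rw [hsm]
    have := aeval_algHom_apply ((g.restrictScalars A).toAlgHom) (r : L) F
    rw [hr, map_zero] at this
    exact this
  have hrr : ∀ r ∈ rs, (F.map (algebraMap A L)).IsRoot (r : L) := by
    intro r hr
    rw [IsScalarTower.algebraMap_eq A S L, ← Polynomial.map_map, hrs]
    change eval (algebraMap S L r) _ = 0
    rw [eval_map_algebraMap, aeval_algebraMap_apply]
    rw [Polynomial.coe_aeval_eq_eval, eval_multiset_prod]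
    rw [Multiset.prod_eq_zero, map_zero]
    rw [Multiset.map_map]
    exact Multiset.mem_map.2 ⟨r, hr, by simp⟩
  refine ⟨σ, ?_, ?_⟩
  · intro z hz
    obtain ⟨r, hr, rfl⟩ := hroot z hz
    rw [← hsm]
    congr 1
    apply hinj _ (hmem _ (hst _ _ hz)) _ hr
    change Ideal.Quotient.mk Q (σ ^ n • r) = Ideal.Quotient.mk Q r
    rw [hσk]
    have h3 : (((F.map ev).map j)).IsRoot (mk r) := by
      rw [← mem_roots ((hF.map _).map _).ne_zero, hroots]
      exact Multiset.mem_map_of_mem _ hr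
    have h4 := h3.dvd (Polynomial.map_dvd j h1)
    simp [IsRoot] at h4
    exact sub_eq_zero.1 h4
  · intro hm1
    apply h2
    rw [← Polynomial.map_dvd_map j j.injective (hF.map _)]
    rw [Polynomial.map_sub, Polynomial.map_pow, map_X]
    rw [hprod]
    by_cases hz : (X ^ p ^ m - X : (S ⧸ Q)[X]) = 0
    · rw [hz]; exact dvd_zero _
    rw [Multiset.prod_X_sub_C_dvd_iff_le_roots hz, Multiset.le_iff_subset hnd]
    intro x hx
    obtain ⟨r, hr, rfl⟩ := Multiset.mem_map.1 hx
    rw [mem_roots hz, IsRoot, eval_sub, eval_pow, eval_X, sub_eq_zero]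
    change (Ideal.Quotient.mk Q r) ^ p ^ m = _
    rw [← hσk, hm1, one_smul]

lemma f_deg : f.natDegree = 12 := by
  unfold f
  compute_degree!

noncomputable instance algZ : Algebra ℤ[X] (RatFunc ℚ) :=
  ((algebraMap ℚ[X] (RatFunc ℚ)).comp (mapRingHom (Int.castRingHom ℚ))).toAlgebra

lemma algZ_def (q : ℤ[X]) : algebraMap ℤ[X] (RatFunc ℚ) q
    = algebraMap ℚ[X] (RatFunc ℚ) (q.map (Int.castRingHom ℚ)) := rfl

lemma algZ_X : algebraMap ℤ[X] (RatFunc ℚ) X = t := by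
  rw [algZ_def, map_X, RatFunc.algebraMap_X]; rfl

instance fracZ : IsFractionRing ℤ[X] (RatFunc ℚ) := by
  have hinj : Function.Injective (algebraMap ℤ[X] (RatFunc ℚ)) :=
    (RatFunc.algebraMap_injective ℚ).comp (map_injective _ Int.cast_injective)
  have : FaithfulSMul ℤ[X] (RatFunc ℚ) := (faithfulSMul_iff_algebraMap_injective _ _).2 hinj
  have key : ∀ q : ℚ[X], ∃ (n : ℤ) (P : ℤ[X]), n ≠ 0 ∧ P.map (Int.castRingHom ℚ) = C (n : ℚ) * q := by
    intro q
    obtain ⟨b, hb0, hb⟩ := IsLocalization.integerNormalization_spec (nonZeroDivisors ℤ) q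
    refine ⟨b, IsLocalization.integerNormalization (nonZeroDivisors ℤ) q,
      nonZeroDivisors.ne_zero hb0, ?_⟩
    · exact hb.trans (by rw [zsmul_eq_mul]; simp)
  apply IsFractionRing.of_field
  intro z
  obtain ⟨n, P, hn, hP⟩ := key z.num
  obtain ⟨m, Q, hm, hQ⟩ := key z.denom
  refine ⟨C m * P, C n * Q, ?_⟩
  have hm' : (algebraMap ℚ[X] (RatFunc ℚ)) (C (m : ℚ)) ≠ 0 := by
    apply RatFunc.algebraMap_ne_zero; simpa using hm
  have hn' : (algebraMap ℚ[X] (RatFunc ℚ)) (C (n : ℚ)) ≠ 0 := by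
    apply RatFunc.algebraMap_ne_zero; simpa using hn
  conv_lhs => rw [← RatFunc.num_div_denom z]
  rw [algZ_def, algZ_def, Polynomial.map_mul, Polynomial.map_mul, hP, hQ, Polynomial.map_C,
    Polynomial.map_C, map_mul, map_mul, map_mul, map_mul]
  have hd : (algebraMap ℚ[X] (RatFunc ℚ)) z.denom ≠ 0 := by
    exact RatFunc.algebraMap_ne_zero z.denom_ne_zero
  simp only [eq_intCast] at *
  field_simp

noncomputable def Fb {R : Type*} [CommRing R] (t : R) : R[X] :=
  (X ^ 2 - 4 * X - 16) ^ 5 * (X ^ 2 - 4 * X - 1) -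
    C (64 * t) * (X ^ 3 * (X - 4) ^ 3 * (X ^ 3 - 128))

lemma Fb_map {R S : Type*} [CommRing R] [CommRing S] (φ : R →+* S) (t : R) :
    (Fb t).map φ = Fb (φ t) := by
  have h64 : φ 64 = 64 := map_ofNat φ 64
  simp [Fb, h64]

lemma Fb_deg {R : Type*} [CommRing R] [Nontrivial R] (t : R) : (Fb t).natDegree = 12 := by
  unfold Fb
  compute_degree!

lemma Fb_monic {R : Type*} [CommRing R] (t : R) : (Fb t).Monic := by
  nontriviality R
  rw [Monic, leadingCoeff, Fb_deg]
  unfold Fb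
  compute_degree!

lemma Fb_eval {R : Type*} [CommRing R] (t y : R) : (Fb t).eval y =
   (y ^ 2 - 4 * y - 16) ^ 5 * (y ^ 2 - 4 * y - 1) -
    64 * t * (y ^ 3 * (y - 4) ^ 3 * (y ^ 3 - 128)) := by
  simp [Fb]

lemma root_iff {L : Type*} [Field L] [Algebra (RatFunc ℚ) L] (x : L) :
    (f.map (algebraMap (RatFunc ℚ) L)).IsRoot x ↔
      (Fb (algebraMap (RatFunc ℚ) L t)).IsRoot (4 * x) := by
  have : CharZero L := charZero_of_injective_algebraMap (algebraMap (RatFunc ℚ) L).injective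
  rw [IsRoot, IsRoot, Fb_eval]
  have : 4 ^ 12 * (f.map (algebraMap (RatFunc ℚ) L)).eval x = (((4 * x) ^ 2 - 4 * (4 * x) - 16) ^ 5 * ((4 * x) ^ 2 - 4 * (4 * x) - 1) -
    64 * (algebraMap (RatFunc ℚ) L t) * ((4 * x) ^ 3 * ((4 * x) - 4) ^ 3 * ((4 * x) ^ 3 - 128))) := by
    simp only [f, Polynomial.map_sub, Polynomial.map_mul, Polynomial.map_pow, map_X, Polynomial.map_one, Polynomial.map_C, map_div₀, map_one, map_ofNat, Polynomial.map_ofNat, eval_sub, eval_mul, eval_pow, eval_X, eval_one, eval_C, eval_ofNat]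
    ring
  rw [← this]
  simp

lemma f_ne : f ≠ 0 := by
  intro h
  have := f_deg
  rw [h] at this; simp at this

lemma Fb_splits {L : Type*} [Field L] [Algebra (RatFunc ℚ) L]
    (h : (f.map (algebraMap (RatFunc ℚ) L)).Splits) :
    (Fb (algebraMap (RatFunc ℚ) L t)).Splits := by
  have : CharZero L := charZero_of_injective_algebraMap (algebraMap (RatFunc ℚ) L).injective
  have e : Fb (algebraMap (RatFunc ℚ) L t) = C (4 ^ 12) * (f.map (algebraMap (RatFunc ℚ) L)).comp (C (1 / 4) * X) := by
    have : ∀ x : L, (4 : L) * (1 / 4 * x) = x := by intro x; field_simp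
    apply Polynomial.funext
    intro x
    rw [eval_mul, eval_C, eval_comp, eval_mul, eval_C, eval_X, Fb_eval]
    simp only [f, Polynomial.map_sub, Polynomial.map_mul, Polynomial.map_pow, map_X, Polynomial.map_one, Polynomial.map_C, map_div₀, map_one, map_ofNat, Polynomial.map_ofNat, eval_sub, eval_mul, eval_pow, eval_X, eval_one, eval_C, eval_ofNat]
    ring
  rw [e]
  apply Splits.C_mul
  exact h.comp_of_natDegree_le_one (by compute_degree)

lemma lev_map {R S : Type*} [CommRing R] [CommRing S] (φ : R →+* S) (α : R) (l : List ℕ) :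
    φ (lev α l) = lev (φ α) l := by
  induction l with
  | nil => simp [lev]
  | cons c l ih => simp [lev, ih]

lemma lev_coeff {R : Type*} [CommRing R] (l : List ℕ) (j : ℕ) :
    (lev (X : R[X]) l).coeff j = (l.getD j 0 : ℕ) := by
  induction l generalizing j with
  | nil => simp [lev]
  | cons c l ih =>
    cases j with
    | zero => simp [lev]
    | succ j =>
      rw [lev, coeff_add, coeff_X_mul, ih, ← C_eq_natCast, coeff_C_succ]
      simp

def okm (p : ℕ) (l : List ℕ) : Bool :=
  decide (l.length ≤ 12) && ((List.range 12).any (fun j => decide (2 ≤ j) && decide (l.getD j 0 % p ≠ 0)))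

def okn (l : List ℕ) : Bool :=
  l.take 2 == [0, 1] && (l.drop 2).all (fun x => x == 0)

lemma lev_zero {R : Type*} [CommRing R] (α : R) (l : List ℕ) (h : l.all (fun x => x == 0) = true) :
    lev α l = 0 := by
  induction l with
  | nil => rfl
  | cons c l ih =>
    simp only [List.all_cons, Bool.and_eq_true, beq_iff_eq] at h
    simp [lev, h.1, ih h.2]

lemma lev_okn {R : Type*} [CommRing R] (α : R) (l : List ℕ) (h : okn l = true) : lev α l = α := by
  simp only [okn, Bool.and_eq_true, beq_iff_eq] at h
  rw [← List.take_append_drop 2 l, lev_append, lev_zero α _ h.2, h.1]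
  simp [lev]

lemma frob_dvd (p t0 n m : ℕ) [Fact p.Prime] (red : List ℕ)
    (hred : ∀ (R : Type) [CommRing R] (α : R), (p : R) = 0 →
      (α ^ 2 - 4 * α - 16) ^ 5 * (α ^ 2 - 4 * α - 1) -
        64 * (t0 : R) * (α ^ 3 * (α - 4) ^ 3 * (α ^ 3 - 128)) = 0 → α ^ 12 = lev α red)
    (h1 : okn (lfr p red n) = true) (h2 : okm p (lfr p red m) = true) :
    Fb (t0 : ZMod p) ∣ X ^ p ^ n - X ∧ ¬ Fb (t0 : ZMod p) ∣ X ^ p ^ m - X := by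
  let F0 : (ZMod p)[X] := Fb (t0 : ZMod p)
  have hF0 : F0.Monic := Fb_monic _
  let α := AdjoinRoot.root F0
  have hpR : (p : AdjoinRoot F0) = 0 := by
    have := congrArg (AdjoinRoot.of F0) (CharP.cast_eq_zero (ZMod p) p)
    rwa [map_natCast, map_zero] at this
  have hα : α ^ 12 = lev α red := by
    apply hred _ _ hpR
    have := AdjoinRoot.eval₂_root F0
    rw [← eval_map, Fb_map, Fb_eval] at this
    simpa using this
  have hlev : ∀ l, lev α l = AdjoinRoot.mk F0 (lev X l) := by
    intro l; rw [lev_map, AdjoinRoot.mk_X]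
  have hfr := lev_lfr p hpR α red hα
  have d1 : F0 ∣ X ^ p ^ n - X := by
    rw [← AdjoinRoot.mk_eq_zero, map_sub, map_pow, AdjoinRoot.mk_X, sub_eq_zero, ← hfr n]
    exact lev_okn _ _ h1
  have d2 : ¬ F0 ∣ X ^ p ^ m - X := by
    intro hd
    rw [← AdjoinRoot.mk_eq_zero, map_sub, map_pow, AdjoinRoot.mk_X, sub_eq_zero, ← hfr m, hlev,
      ← AdjoinRoot.mk_X, ← sub_eq_zero, ← map_sub, AdjoinRoot.mk_eq_zero] at hd
    simp only [okm, Bool.and_eq_true, decide_eq_true_eq, List.any_eq_true] at h2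
    obtain ⟨hl, j, -, hj2, hj⟩ := h2
    have hz : (lev X (lfr p red m) - X : (ZMod p)[X]) = 0 := by
      apply eq_zero_of_dvd_of_natDegree_lt hd
      rw [show F0.natDegree = 12 from Fb_deg _]
      have : (lev X (lfr p red m) - X : (ZMod p)[X]).natDegree ≤ 11 := by
        rw [natDegree_le_iff_coeff_eq_zero]
        intro N hN
        rw [coeff_sub, lev_coeff, coeff_X_of_ne_one (by omega), List.getD_eq_default _ _ (by omega)]
        simp
      omega
    have := congrArg (fun q => coeff q j) hz
    simp only [coeff_sub, lev_coeff, coeff_zero] at this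
    rw [coeff_X_of_ne_one (by omega), sub_zero, ZMod.natCast_eq_zero_iff] at this
    exact hj (Nat.mod_eq_zero_of_dvd this)
  exact ⟨d1, d2⟩

lemma galf : IsGalois (RatFunc ℚ) f.SplittingField := by
  have h1 : Normal (RatFunc ℚ) f.SplittingField := Normal.of_isSplittingField f
  exact ⟨⟩

lemma mapZ {L : Type*} [Field L] [Algebra (RatFunc ℚ) L] [Algebra ℤ[X] L]
    [IsScalarTower ℤ[X] (RatFunc ℚ) L] : (Fb (X : ℤ[X])).map (algebraMap ℤ[X] L) =
      Fb (algebraMap (RatFunc ℚ) L t) := by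
  rw [Fb_map, IsScalarTower.algebraMap_apply ℤ[X] (RatFunc ℚ) L, algZ_X]

lemma frob' {L : Type*} [Field L] [Algebra (RatFunc ℚ) L] [Algebra ℤ[X] L]
    [IsScalarTower ℤ[X] (RatFunc ℚ) L] [FiniteDimensional (RatFunc ℚ) L] [IsGalois (RatFunc ℚ) L]
    (hs : (f.map (algebraMap (RatFunc ℚ) L)).Splits) (p t0 n m : ℕ) [Fact p.Prime] (hn : n ≠ 0)
    (h1 : Fb (t0 : ZMod p) ∣ X ^ p ^ n - X) (h2 : ¬ Fb (t0 : ZMod p) ∣ X ^ p ^ m - X) :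
    ∃ s : Gal(L/RatFunc ℚ), (∀ x, (f.map (algebraMap (RatFunc ℚ) L)).IsRoot x → (s ^ n) x = x) ∧
      s ^ m ≠ 1 := by
  let ev : ℤ[X] →+* ZMod p := eval₂RingHom (Int.castRingHom (ZMod p)) t0
  have hev : Function.Surjective ev := by
    intro x
    obtain ⟨k, rfl⟩ := ZMod.intCast_surjective x
    exact ⟨C k, by simp [ev]⟩
  have hmap : (Fb (X : ℤ[X])).map ev = Fb (t0 : ZMod p) := by
    rw [Fb_map]; simp [ev]
  have hs' : ((Fb (X : ℤ[X])).map (algebraMap ℤ[X] L)).Splits := by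
    rw [mapZ]; exact Fb_splits hs
  have : CharZero L := charZero_of_injective_algebraMap (algebraMap (RatFunc ℚ) L).injective
  obtain ⟨σ, hσ1, hσ2⟩ := frob_abs (K := RatFunc ℚ) (L := L) (Fb (X : ℤ[X])) (Fb_monic _) hs' p ev
    hev n m hn (by rw [hmap]; exact h1) (by rw [hmap]; exact h2)
  refine ⟨σ, ?_, hσ2⟩
  intro x hx
  have := hσ1 (4 * x) (by rw [mapZ]; exact (root_iff x).1 hx)
  rw [map_mul, map_ofNat] at this
  exact mul_left_cancel₀ (by norm_num) this

lemma frob (p t0 n m : ℕ) [Fact p.Prime] (hn : n ≠ 0) (red : List ℕ)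
    (hred : ∀ (R : Type) [CommRing R] (α : R), (p : R) = 0 →
      (α ^ 2 - 4 * α - 16) ^ 5 * (α ^ 2 - 4 * α - 1) -
        64 * (t0 : R) * (α ^ 3 * (α - 4) ^ 3 * (α ^ 3 - 128)) = 0 → α ^ 12 = lev α red)
    (h1 : okn (lfr p red n) = true) (h2 : okm p (lfr p red m) = true) :
    ∃ s : f.Gal, s ^ n = 1 ∧ s ^ m ≠ 1 := by
  obtain ⟨d1, d2⟩ := frob_dvd p t0 n m red hred h1 h2
  have := galf
  obtain ⟨σ, hσ1, hσ2⟩ := frob' (L := f.SplittingField) (SplittingField.splits f) p t0 n m hn d1 d2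
  refine ⟨σ, ?_, hσ2⟩
  apply Gal.ext
  intro x hx
  exact hσ1 x (by
    rw [mem_rootSet] at hx
    rw [IsRoot, eval_map_algebraMap]; exact hx.2)

def rd7_3 : List ℕ := [3, 0, 2, 4, 2, 0, 3, 6, 4, 6, 2, 3]
lemma cert7_3 : (∃ s : f.Gal, s ^ 11 = 1 ∧ s ^ 1 ≠ 1) := by
  have : Fact (Nat.Prime 7) := ⟨by norm_num⟩
  refine frob 7 3 11 1 (by norm_num) rd7_3 ?_ (by decide +kernel) (by decide +kernel)
  intro R _ α hp h
  have hp' : (7 : R) = 0 := by exact_mod_cast hp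
  simp only [lev, rd7_3]
  push_cast
  push_cast at h
  linear_combination h - ((149797) * α ^ 0 + (786432) * α ^ 1 + (645998) * α ^ 2 + (-248100) * α ^ 3 + (19310) * α ^ 4 + (-52224) * α ^ 5 + (21029) * α ^ 6 + (-822) * α ^ 7 + (-596) * α ^ 8 + (22) * α ^ 9 + (23) * α ^ 10 + (-3) * α ^ 11) * hp'

def rd7_4 : List ℕ := [3, 0, 2, 6, 4, 3, 0, 5, 6, 0, 2, 3]
lemma cert7_4 : (∃ s : f.Gal, s ^ 8 = 1 ∧ s ^ 4 ≠ 1) := by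
  have : Fact (Nat.Prime 7) := ⟨by norm_num⟩
  refine frob 7 4 8 4 (by norm_num) rd7_4 ?_ (by decide +kernel) (by decide +kernel)
  intro R _ α hp h
  have hp' : (7 : R) = 0 := by exact_mod_cast hp
  simp only [lev, rd7_4]
  push_cast
  push_cast at h
  linear_combination h - ((149797) * α ^ 0 + (786432) * α ^ 1 + (645998) * α ^ 2 + (-322998) * α ^ 3 + (75484) * α ^ 4 + (-66267) * α ^ 5 + (22784) * α ^ 6 + (-1261) * α ^ 7 + (-486) * α ^ 8 + (12) * α ^ 9 + (23) * α ^ 10 + (-3) * α ^ 11) * hp'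

def rd11_1 : List ℕ := [10, 3, 6, 1, 9, 0, 4, 1, 3, 10, 6, 2]
lemma cert11_1 : (∃ s : f.Gal, s ^ 5 = 1 ∧ s ^ 1 ≠ 1) := by
  have : Fact (Nat.Prime 11) := ⟨by norm_num⟩
  refine frob 11 1 5 1 (by norm_num) rd11_1 ?_ (by decide +kernel) (by decide +kernel)
  intro R _ α hp h
  have hp' : (11 : R) = 0 := by exact_mod_cast hp
  simp only [lev, rd11_1]
  push_cast
  push_cast at h
  linear_combination h - ((95326) * α ^ 0 + (500457) * α ^ 1 + (411090) * α ^ 2 + (-62557) * α ^ 3 + (-59205) * α ^ 4 + (-15360) * α ^ 5 + (11148) * α ^ 6 + (35) * α ^ 7 + (-519) * α ^ 8 + (26) * α ^ 9 + (15) * α ^ 10 + (-2) * α ^ 11) * hp'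

def rd11_2 : List ℕ := [10, 3, 6, 7, 10, 8, 3, 4, 5, 8, 6, 2]
lemma cert11_2 : (∃ s : f.Gal, s ^ 6 = 1 ∧ s ^ 2 ≠ 1) := by
  have : Fact (Nat.Prime 11) := ⟨by norm_num⟩
  refine frob 11 2 6 2 (by norm_num) rd11_2 ?_ (by decide +kernel) (by decide +kernel)
  intro R _ α hp h
  have hp' : (11 : R) = 0 := by exact_mod_cast hp
  simp only [lev, rd11_2]
  push_cast
  push_cast at h
  linear_combination h - ((95326) * α ^ 0 + (500457) * α ^ 1 + (411090) * α ^ 2 + (-110219) * α ^ 3 + (-23458) * α ^ 4 + (-24296) * α ^ 5 + (12265) * α ^ 6 + (-244) * α ^ 7 + (-449) * α ^ 8 + (20) * α ^ 9 + (15) * α ^ 10 + (-2) * α ^ 11) * hp'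

lemma card_dvd_abs {G : Type*} [Group G] (c1 : ∃ s : G, s ^ 11 = 1 ∧ s ^ 1 ≠ 1)
    (c2 : ∃ s : G, s ^ 5 = 1 ∧ s ^ 1 ≠ 1) (c3 : ∃ s : G, s ^ 6 = 1 ∧ s ^ 2 ≠ 1)
    (c4 : ∃ s : G, s ^ 8 = 1 ∧ s ^ 4 ≠ 1) : 1320 ∣ Nat.card G := by
  have h11 : 11 ∣ Nat.card G := by
    obtain ⟨s, h1, h2⟩ := c1
    have : Fact (Nat.Prime 11) := ⟨by norm_num⟩
    rw [pow_one] at h2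
    exact (orderOf_eq_prime h1 h2) ▸ orderOf_dvd_natCard s
  have h5 : 5 ∣ Nat.card G := by
    obtain ⟨s, h1, h2⟩ := c2
    have : Fact (Nat.Prime 5) := ⟨by norm_num⟩
    rw [pow_one] at h2
    exact (orderOf_eq_prime h1 h2) ▸ orderOf_dvd_natCard s
  have h3 : 3 ∣ Nat.card G := by
    obtain ⟨s, h1, h2⟩ := c3
    have : Fact (Nat.Prime 3) := ⟨by norm_num⟩
    have h3 : (s ^ 2) ^ 3 = 1 := by rw [← pow_mul]; exact h1
    exact (orderOf_eq_prime h3 h2) ▸ orderOf_dvd_natCard (s ^ 2)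
  have h8 : 8 ∣ Nat.card G := by
    obtain ⟨s, h1, h2⟩ := c4
    have : Fact (Nat.Prime 2) := ⟨by norm_num⟩
    have h := orderOf_eq_prime_pow (x := s) (p := 2) (n := 2) h2 h1
    have h' : orderOf s = 8 := h
    exact h' ▸ orderOf_dvd_natCard s
  have e1 := Nat.Coprime.mul_dvd_of_dvd_of_dvd (by norm_num) h11 h5
  have e2 := Nat.Coprime.mul_dvd_of_dvd_of_dvd (by norm_num) h3 h8
  exact Nat.Coprime.mul_dvd_of_dvd_of_dvd (m := 55) (n := 24) (by norm_num) e1 e2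

lemma card_dvd : 1320 ∣ Nat.card f.Gal :=
  card_dvd_abs cert7_3 cert11_1 cert11_2 cert7_4

def lz {R : Type*} [CommRing R] (x : R) : List ℤ → R
  | [] => 0
  | a :: l => (a : R) + x * lz x l

def pe {R : Type*} [CommRing R] (u v K : R) (e : List ℤ × List ℤ) : R :=
  u * lz K e.1 + v * lz K e.2

def pg {R : Type*} [CommRing R] (u v K y : R) : List (List ℤ × List ℤ) → R
  | [] => 0
  | e :: l => pe u v K e + y * pg u v K y l

def cP0 : List ℤ × List ℤ := ([3439853568, -658243584, 120143872, -8474624, -266240], [21233664, -1900544, 266240])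
def cP1 : List ℤ × List ℤ := ([9029615616, -760430592, 282531840, -13412352, 172032], [55738368, 11433984, -172032])
def cP2 : List ℤ × List ℤ := ([-2257403904, 109486080, -164857344, 8226048, -84480], [39813120, -7254528, 84480])
def cP3 : List ℤ × List ℤ := ([214990848, -78091776, 35388544, -1202368, 7040, -128], [-28905984, 1239424, -5568, 128])
def cP4 : List ℤ × List ℤ := ([-161243136, 43452288, -3451872, -8400, -480], [3203712, 13920, 480])
def cP5 : List ℤ × List ℤ := ([40310784, -7713792, 148224, 13440, 768], [248832, -22272, -768])
def cP6 : List ℤ × List ℤ := ([-3359232, 642816, -12352, -1120, -64], [-20736, 1856, 64])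
def cQ0 : List ℤ × List ℤ := ([0, -7739670528, 1409384448, -138645504, 7335936, 258048], [0, -35831808, 3133440, -258048])
def cQ1 : List ℤ × List ℤ := ([-34828517376, -14941863936, 2066466816, -321214464, 13215744, -221184], [-644972544, -9787392, -10672128, 221184])
def cQ2 : List ℤ × List ℤ := ([8707129344, 11475136512, -1554992640, 204429312, -7575552, 13824], [403107840, -79667712, 7416576, -13824])
def cQ3 : List ℤ × List ℤ := ([4353564672, -2811677184, 362434176, -39016384, 1242048, -4800, -128], [-63825408, 35862912, -1278784, 6272, 128])
def cQ4 : List ℤ × List ℤ := ([-2176782336, 373714560, -38504160, 2120256, 36288, 2592], [12597120, -4927392, -66096, -2592])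
def cQ5 : List ℤ × List ℤ := ([272097792, -34432128, 2623104, 10368, -20736], [-2519424, 228096, 20736])
def k1L : List ℤ := [176319369216, -155367839232, 13400816256, 6167549952, -1536533712, 167331744, -10900008, 400869, -7722, 137]
def k2L : List ℤ := [-6802444800, 1292464512, 283435200, -83455920, 6928416, -288684, 8829, -54, 1]
def la : List ℤ := [-104976, 20088, -386, -35, -2]
def lb : List ℤ := [-648, 58, 2]
def ta : List ℤ := [57127475625984, -11196279945216, -2684244718080, 779719737600, -38893411008, -708823424, 148894016, -5445120, 85760, -512]
def tb : List ℤ := [-1498714638336, -197815094784, 44916291072, -363911616, -94438016, 4511040, -79872, 512]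
def cT : List ℤ × List ℤ := (ta, tb)
def cL : List ℤ × List ℤ := (la, lb)
def cD : List ℤ := [81, -7, 1]
def cC : List ℤ := [1296, -216, 0, 1]
def PL : List (List ℤ × List ℤ) := [cP0, cP1, cP2, cP3, cP4, cP5, cP6]
def QL : List (List ℤ × List ℤ) := [cQ0, cQ1, cQ2, cQ3, cQ4, cQ5]

def q4 {R : Type*} [CommRing R] (K : R) : R := K * (K - 16) * (K ^ 2 - 7 * K + 81)

lemma hco0 {R : Type*} [CommRing R] (K W : R) (hW : W ^ 2 = q4 K) :
    lz K cD * (pe 1 W K cP0 * pe 1 W K cP0) - (pe 1 W K cQ0 * pe 1 W K cQ0) =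
      lz K cD * (1024 * (1048576) * pe 1 W K cL ^ 2 - (0) * pe 1 W K cT) := by
  simp only [lz, pe, cD, cL, cT, la, lb, ta, tb, cP0, cQ0]
  push_cast
  unfold q4 at hW
  linear_combination ((-142657607172096)*K^2 + (23776267862016)*K^3 + (-110075314176)*K^5) * hW

lemma hco1 {R : Type*} [CommRing R] (K W : R) (hW : W ^ 2 = q4 K) :
    lz K cD * (2 * (pe 1 W K cP0 * pe 1 W K cP1)) - (2 * (pe 1 W K cQ0 * pe 1 W K cQ1)) =
      lz K cD * (1024 * (5505024) * pe 1 W K cL ^ 2 - (0) * pe 1 W K cT) := by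
  simp only [lz, pe, cD, cL, cT, la, lb, ta, tb, cP0, cP1, cQ0, cQ1]
  push_cast
  unfold q4 at hW
  linear_combination ((10271347716390912)*K^1 + (-3602104581095424)*K^2 + (279371147378688)*K^3 + (4953389137920)*K^4 + (-660451885056)*K^5) * hW

lemma hco2 {R : Type*} [CommRing R] (K W : R) (hW : W ^ 2 = q4 K) :
    lz K cD * (2 * (pe 1 W K cP0 * pe 1 W K cP2) + pe 1 W K cP1 * pe 1 W K cP1) - (2 * (pe 1 W K cQ0 * pe 1 W K cQ2) + pe 1 W K cQ1 * pe 1 W K cQ1) =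
      lz K cD * (1024 * (4521984) * pe 1 W K cL ^ 2 - (0) * pe 1 W K cT) := by
  simp only [lz, pe, cD, cL, cT, la, lb, ta, tb, cP0, cP1, cP2, cQ0, cQ1, cQ2]
  push_cast
  unfold q4 at hW
  linear_combination ((-184884258895036416)*K^0 + (90516251750694912)*K^1 + (-14399502223933440)*K^2 + (611495889076224)*K^3 + (31082516840448)*K^4 + (-949399584768)*K^5) * hW

lemma hco3 {R : Type*} [CommRing R] (K W : R) (hW : W ^ 2 = q4 K) :
    lz K cD * (2 * (pe 1 W K cP0 * pe 1 W K cP3) + 2 * (pe 1 W K cP1 * pe 1 W K cP2)) - (2 * (pe 1 W K cQ0 * pe 1 W K cQ3) + 2 * (pe 1 W K cQ1 * pe 1 W K cQ2)) =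
      lz K cD * (1024 * (-163840) * pe 1 W K cL ^ 2 - (524288) * pe 1 W K cT) := by
  simp only [lz, pe, cD, cL, cT, la, lb, ta, tb, cP0, cP1, cP2, cP3, cQ0, cQ1, cQ2, cQ3]
  push_cast
  unfold q4 at hW
  linear_combination ((785758100303904768)*K^0 + (-102035853529841664)*K^1 + (5679941249138688)*K^2 + (-98988878462976)*K^3 + (-8795061223424)*K^4 + (1115821178880)*K^5 + (-23773839360)*K^6 + (134217728)*K^7) * hW

lemma hco4 {R : Type*} [CommRing R] (K W : R) (hW : W ^ 2 = q4 K) :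
    lz K cD * (2 * (pe 1 W K cP0 * pe 1 W K cP4) + 2 * (pe 1 W K cP1 * pe 1 W K cP3) + pe 1 W K cP2 * pe 1 W K cP2) - (2 * (pe 1 W K cQ0 * pe 1 W K cQ4) + 2 * (pe 1 W K cQ1 * pe 1 W K cQ3) + pe 1 W K cQ2 * pe 1 W K cQ2) =
      lz K cD * (1024 * (-1044480) * pe 1 W K cL ^ 2 - (-393216) * pe 1 W K cT) := by
  simp only [lz, pe, cD, cL, cT, la, lb, ta, tb, cP0, cP1, cP2, cP3, cP4, cQ0, cQ1, cQ2, cQ3, cQ4]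
  push_cast
  unfold q4 at hW
  linear_combination ((-330047290293092352)*K^0 + (20917171651608576)*K^1 + (288369804312576)*K^2 + (-9300344832000)*K^3 + (9045901639680)*K^4 + (-741409947648)*K^5 + (15250489344)*K^6 + (-100663296)*K^7) * hW

lemma hco5 {R : Type*} [CommRing R] (K W : R) (hW : W ^ 2 = q4 K) :
    lz K cD * (2 * (pe 1 W K cP0 * pe 1 W K cP5) + 2 * (pe 1 W K cP1 * pe 1 W K cP4) + 2 * (pe 1 W K cP2 * pe 1 W K cP3)) - (2 * (pe 1 W K cQ0 * pe 1 W K cQ5) + 2 * (pe 1 W K cQ1 * pe 1 W K cQ4) + 2 * (pe 1 W K cQ2 * pe 1 W K cQ3)) =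
      lz K cD * (1024 * (-70656) * pe 1 W K cL ^ 2 - (98304) * pe 1 W K cT) := by
  simp only [lz, pe, cD, cL, cT, la, lb, ta, tb, cP0, cP1, cP2, cP3, cP4, cP5, cQ0, cQ1, cQ2, cQ3, cQ4, cQ5]
  push_cast
  unfold q4 at hW
  linear_combination ((-86483945322971136)*K^0 + (15383616810909696)*K^1 + (-119180606570496)*K^2 + (-81518764621824)*K^3 + (-4688829579264)*K^4 + (214376251392)*K^5 + (-3812622336)*K^6 + (25165824)*K^7) * hW

lemma hco6 {R : Type*} [CommRing R] (K W : R) (hW : W ^ 2 = q4 K) :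
    lz K cD * (2 * (pe 1 W K cP0 * pe 1 W K cP6) + 2 * (pe 1 W K cP1 * pe 1 W K cP5) + 2 * (pe 1 W K cP2 * pe 1 W K cP4) + pe 1 W K cP3 * pe 1 W K cP3) - (2 * (pe 1 W K cQ1 * pe 1 W K cQ5) + 2 * (pe 1 W K cQ2 * pe 1 W K cQ4) + pe 1 W K cQ3 * pe 1 W K cQ3) =
      lz K cD * (1024 * (110336) * pe 1 W K cL ^ 2 - (-12288) * pe 1 W K cT) := by
  simp only [lz, pe, cD, cL, cT, la, lb, ta, tb, cP0, cP1, cP2, cP3, cP4, cP5, cP6, cQ1, cQ2, cQ3, cQ4, cQ5]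
  push_cast
  unfold q4 at hW
  linear_combination ((69196183810080768)*K^0 + (-5206724033642496)*K^1 + (-466711162454016)*K^2 + (43613612752896)*K^3 + (607145926656)*K^4 + (-28920066048)*K^5 + (503451648)*K^6 + (-3145728)*K^7) * hW

lemma hco7 {R : Type*} [CommRing R] (K W : R) (hW : W ^ 2 = q4 K) :
    lz K cD * (2 * (pe 1 W K cP1 * pe 1 W K cP6) + 2 * (pe 1 W K cP2 * pe 1 W K cP5) + 2 * (pe 1 W K cP3 * pe 1 W K cP4)) - (2 * (pe 1 W K cQ2 * pe 1 W K cQ5) + 2 * (pe 1 W K cQ3 * pe 1 W K cQ4)) =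
      lz K cD * (1024 * (3456) * pe 1 W K cL ^ 2 - (3072) * pe 1 W K cT) := by
  simp only [lz, pe, cD, cL, cT, la, lb, ta, tb, cP1, cP2, cP3, cP4, cP5, cP6, cQ2, cQ3, cQ4, cQ5]
  push_cast
  unfold q4 at hW
  linear_combination ((-10065720149803008)*K^0 + (-791582542921728)*K^1 + (279396623794176)*K^2 + (-8302873890816)*K^3 + (25016616960)*K^4 + (6457393152)*K^5 + (-119144448)*K^6 + (786432)*K^7) * hW

lemma hco8 {R : Type*} [CommRing R] (K W : R) (hW : W ^ 2 = q4 K) :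
    lz K cD * (2 * (pe 1 W K cP2 * pe 1 W K cP6) + 2 * (pe 1 W K cP3 * pe 1 W K cP5) + pe 1 W K cP4 * pe 1 W K cP4) - (2 * (pe 1 W K cQ3 * pe 1 W K cQ5) + pe 1 W K cQ4 * pe 1 W K cQ4) =
      lz K cD * (1024 * (-6480) * pe 1 W K cL ^ 2 - (-768) * pe 1 W K cT) := by
  simp only [lz, pe, cD, cL, cT, la, lb, ta, tb, cP2, cP3, cP4, cP5, cP6, cQ3, cQ4, cQ5]
  push_cast
  unfold q4 at hW
  linear_combination ((-722204136308736)*K^0 + (512292662083584)*K^1 + (-61834243387392)*K^2 + (645753876480)*K^3 + (-1764540672)*K^4 + (-1614348288)*K^5 + (29786112)*K^6 + (-196608)*K^7) * hW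

lemma hco9 {R : Type*} [CommRing R] (K W : R) (hW : W ^ 2 = q4 K) :
    lz K cD * (2 * (pe 1 W K cP3 * pe 1 W K cP6) + 2 * (pe 1 W K cP4 * pe 1 W K cP5)) - (2 * (pe 1 W K cQ4 * pe 1 W K cQ5)) =
      lz K cD * (1024 * (340) * pe 1 W K cL ^ 2 - (64) * pe 1 W K cT) := by
  simp only [lz, pe, cD, cL, cT, la, lb, ta, tb, cP3, cP4, cP5, cP6, cQ4, cQ5]
  push_cast
  unfold q4 at hW
  linear_combination ((277879325884416)*K^0 + (-70836850778112)*K^1 + (5557916528640)*K^2 + (-15054004224)*K^3 + (-771284992)*K^4 + (134529024)*K^5 + (-2482176)*K^6 + (16384)*K^7) * hW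

lemma hco10 {R : Type*} [CommRing R] (K W : R) (hW : W ^ 2 = q4 K) :
    lz K cD * (2 * (pe 1 W K cP4 * pe 1 W K cP6) + pe 1 W K cP5 * pe 1 W K cP5) - (pe 1 W K cQ5 * pe 1 W K cQ5) =
      lz K cD * (1024 * (159) * pe 1 W K cL ^ 2 - (0) * pe 1 W K cT) := by
  simp only [lz, pe, cD, cL, cT, la, lb, ta, tb, cP4, cP5, cP6, cQ5]
  push_cast
  unfold q4 at hW
  linear_combination ((-17631936921600)*K^0 + (3134566563840)*K^1 + (-139314069504)*K^2) * hW

lemma hco11 {R : Type*} [CommRing R] (K W : R) (hW : W ^ 2 = q4 K) :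
    lz K cD * (2 * (pe 1 W K cP5 * pe 1 W K cP6)) - (0) =
      lz K cD * (1024 * (-24) * pe 1 W K cL ^ 2 - (0) * pe 1 W K cT) := by
  simp only [lz, pe, cD, cL, cT, la, lb, ta, tb, cP5, cP6]
  push_cast
  unfold q4 at hW
  linear_combination (0) * hW

lemma hco12 {R : Type*} [CommRing R] (K W : R) (hW : W ^ 2 = q4 K) :
    lz K cD * (pe 1 W K cP6 * pe 1 W K cP6) - (0) =
      lz K cD * (1024 * (1) * pe 1 W K cL ^ 2 - (0) * pe 1 W K cT) := by
  simp only [lz, pe, cD, cL, cT, la, lb, ta, tb, cP6]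
  push_cast
  unfold q4 at hW
  linear_combination (0) * hW

lemma key_id {R : Type*} [CommRing R] (K W y : R) (hW : W ^ 2 = q4 K) :
    lz K cD * (pg 1 W K y PL) ^ 2 - (pg 1 W K y QL) ^ 2 =
      lz K cD * (1024 * pe 1 W K cL ^ 2 * ((y ^ 2 - 4 * y - 16) ^ 5 * (y ^ 2 - 4 * y - 1)) -
        pe 1 W K cT * (64 * (y ^ 3 * (y - 4) ^ 3 * (y ^ 3 - 128)))) := by
  simp only [pg, PL, QL]
  linear_combination y ^ 0 * hco0 K W hW + y ^ 1 * hco1 K W hW + y ^ 2 * hco2 K W hW + y ^ 3 * hco3 K W hW + y ^ 4 * hco4 K W hW + y ^ 5 * hco5 K W hW + y ^ 6 * hco6 K W hW + y ^ 7 * hco7 K W hW + y ^ 8 * hco8 K W hW + y ^ 9 * hco9 K W hW + y ^ 10 * hco10 K W hW + y ^ 11 * hco11 K W hW + y ^ 12 * hco12 K W hW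

lemma tau_id {R : Type*} [CommRing R] (K W : R) (hW : W ^ 2 = q4 K) :
    16 * lz K cC ^ 3 * pe 1 W K cT = 1024 * pe 1 W K cL ^ 2 * (lz K k1L + lz K k2L * W) := by
  have h : (-1024 * (lz K lb ^ 2 * lz K k1L + 2 * lz K la * lz K lb * lz K k2L
    + lz K lb ^ 2 * lz K k2L * W)) * (W ^ 2 - q4 K) = 0 := by rw [hW]; ring
  simp only [lz, pe, cC, cL, cT, la, lb, ta, tb, k1L, k2L, q4] at h ⊢
  push_cast at h ⊢
  linear_combination h

/-- the degree 11 resolvent -/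
noncomputable def Mp {R : Type*} [CommRing R] (t : R) : R[X] :=
  (X - 36) ^ 5 * (X + 9) ^ 5 * (X + 4) + C (32 * t) * ((176319369216) + (-155367839232) * X ^ 1 + (13400816256) * X ^ 2 + (6167549952) * X ^ 3 + (-1536533712) * X ^ 4 + (167331744) * X ^ 5 + (-10900008) * X ^ 6 + (400869) * X ^ 7 + (-7722) * X ^ 8 + (137) * X ^ 9)
    - C (256 * t ^ 2) * (X ^ 3 - 216 * X + 1296) ^ 3

lemma Mp_map {R S : Type*} [CommRing R] [CommRing S] (φ : R →+* S) (t : R) :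
    (Mp t).map φ = Mp (φ t) := by
  have h64 : φ 32 = 32 := map_ofNat φ 32
  have h65 : φ 256 = 256 := map_ofNat φ 256
  simp [Mp, h64, h65]

lemma Mp_deg {R : Type*} [CommRing R] [Nontrivial R] (t : R) : (Mp t).natDegree = 11 := by
  unfold Mp
  compute_degree!

lemma Mp_monic {R : Type*} [CommRing R] (t : R) : (Mp t).Monic := by
  nontriviality R
  rw [Monic, leadingCoeff, Mp_deg]
  unfold Mp
  compute_degree!

def mv {R : Type*} [CommRing R] (t K : R) : R :=
  (K - 36) ^ 5 * (K + 9) ^ 5 * (K + 4) + 32 * t * lz K k1L - 256 * t ^ 2 * lz K cC ^ 3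

lemma Mp_eval {R : Type*} [CommRing R] (t K : R) : (Mp t).eval K = mv t K := by
  simp only [Mp, mv, lz, k1L, cC, eval_add, eval_sub, eval_mul, eval_pow, eval_X, eval_C,
    eval_neg, eval_ofNat]
  push_cast
  ring

def wn {R : Type*} [CommRing R] (t K : R) : R := 16 * lz K cC ^ 3 * t - lz K k1L

lemma wn_sq {R : Type*} [CommRing R] (t K : R) :
    wn t K ^ 2 - lz K k2L ^ 2 * q4 K = - lz K cC ^ 3 * mv t K := by
  have h : lz K k1L ^ 2 - lz K k2L ^ 2 * q4 K =
      - ((K - 36) ^ 5 * (K + 9) ^ 5 * (K + 4)) * lz K cC ^ 3 := by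
    simp only [lz, k1L, k2L, cC, q4]
    push_cast
    ring
  simp only [wn, mv]
  linear_combination h

lemma pg_smul {R : Type*} [CommRing R] (s u v K y : R) (l : List (List ℤ × List ℤ)) :
    pg (s * u) (s * v) K y l = s * pg u v K y l := by
  induction l with
  | nil => simp [pg]
  | cons e l ih => rw [pg, pg, ih, pe, pe]; ring

def pf {R : Type*} [CommRing R] (t K y : R) : R := pg (lz K k2L) (wn t K) K y PL
def qf {R : Type*} [CommRing R] (t K y : R) : R := pg (lz K k2L) (wn t K) K y QL

lemma main_sq {R : Type*} [Field R] [CharZero R] (t K y : R) (hm : (Mp t).eval K = 0)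
    (hy : (Fb t).eval y = 0) (hc : lz K cC ≠ 0) (hk : lz K k2L ≠ 0) :
    lz K cD * pf t K y ^ 2 = qf t K y ^ 2 := by
  obtain ⟨W, hWd⟩ : ∃ W, wn t K = lz K k2L * W := ⟨wn t K / lz K k2L, by field_simp⟩
  rw [Mp_eval] at hm
  have hW : W ^ 2 = q4 K := by
    have h := wn_sq t K
    rw [hm, hWd] at h
    have h2 : lz K k2L ^ 2 * (W ^ 2 - q4 K) = 0 := by linear_combination h
    have h3 := (mul_eq_zero.1 h2).resolve_left (pow_ne_zero 2 hk)
    exact sub_eq_zero.1 h3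
  have hT : pe 1 W K cT = 1024 * pe 1 W K cL ^ 2 * t := by
    have h := tau_id K W hW
    have h1 : lz K k1L + lz K k2L * W = 16 * lz K cC ^ 3 * t := by
      rw [← hWd, wn]; ring
    rw [h1] at h
    have h2 : (16 * lz K cC ^ 3) * (pe 1 W K cT - 1024 * pe 1 W K cL ^ 2 * t) = 0 := by
      linear_combination h
    have h3 := (mul_eq_zero.1 h2).resolve_left (mul_ne_zero (by norm_num) (pow_ne_zero 3 hc))
    exact sub_eq_zero.1 h3
  have hkey := key_id K W y hW
  rw [hT] at hkey
  rw [Fb_eval] at hy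
  have e1 : ∀ l, pg (lz K k2L) (wn t K) K y l = lz K k2L * pg 1 W K y l := by
    intro l
    rw [← pg_smul, hWd, mul_one]
  rw [pf, qf, e1, e1]
  linear_combination lz K k2L ^ 2 * hkey + lz K k2L ^ 2 * lz K cD * 1024 * pe 1 W K cL ^ 2 * hy

lemma lz_map {R S F : Type*} [CommRing R] [CommRing S] [FunLike F R S] [RingHomClass F R S]
    (φ : F) (x : R) (l : List ℤ) : φ (lz x l) = lz (φ x) l := by
  induction l with
  | nil => simp [lz]
  | cons a l ih => simp [lz, ih]

lemma pg_map {R S F : Type*} [CommRing R] [CommRing S] [FunLike F R S] [RingHomClass F R S]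
    (φ : F) (u v K y : R) (l : List (List ℤ × List ℤ)) :
    φ (pg u v K y l) = pg (φ u) (φ v) (φ K) (φ y) l := by
  induction l with
  | nil => simp [pg]
  | cons a l ih => simp [pg, ih, pe, lz_map]

lemma wn_map {R S F : Type*} [CommRing R] [CommRing S] [FunLike F R S] [RingHomClass F R S]
    (φ : F) (t K : R) : φ (wn t K) = wn (φ t) (φ K) := by
  have h : φ 16 = 16 := map_ofNat φ 16
  simp [wn, lz_map, h]

lemma pf_map {R S F : Type*} [CommRing R] [CommRing S] [FunLike F R S] [RingHomClass F R S]
    (φ : F) (t K y : R) : φ (pf t K y) = pf (φ t) (φ K) (φ y) := by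
  simp [pf, pg_map, wn_map, lz_map]

lemma qf_map {R S F : Type*} [CommRing R] [CommRing S] [FunLike F R S] [RingHomClass F R S]
    (φ : F) (t K y : R) : φ (qf t K y) = qf (φ t) (φ K) (φ y) := by
  simp [qf, pg_map, wn_map, lz_map]

def yb : Fin 12 → ZMod 487 := fun i => 4 * ![41,130,162,193,233,255,257,366,376,441,475,486] i
def kb : Fin 11 → ZMod 487 := ![138,163,175,182,226,266,325,333,376,406,463]

lemma yb_inj : Function.Injective yb := by
  unfold Function.Injective; decide +kernel
lemma kb_inj : Function.Injective kb := by
  unfold Function.Injective; decide +kernel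
lemma yb_root : ∀ i, (yb i ^ 2 - 4 * yb i - 16) ^ 5 * (yb i ^ 2 - 4 * yb i - 1) -
    64 * 336 * (yb i ^ 3 * (yb i - 4) ^ 3 * (yb i ^ 3 - 128)) = 0 := by decide +kernel
lemma kb_root : ∀ b, mv 336 (kb b) = 0 := by decide +kernel
lemma kb_ne : ∀ b, lz (kb b) cC ≠ 0 ∧ lz (kb b) k2L ≠ 0 := by decide +kernel
lemma pq_ne : ∀ b i, pf 336 (kb b) (yb i) ≠ 0 ∧ qf 336 (kb b) (yb i) ≠ 0 := by decide +kernel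
lemma sm_tab : ∀ b i j, (pf 336 (kb b) (yb i) * qf 336 (kb b) (yb j) =
    pf 336 (kb b) (yb j) * qf 336 (kb b) (yb i)) ↔ sm b i j = true := by decide +kernel

lemma lab {A L k0 k : Type*} [CommRing A] [Field L] [Algebra A L] [Field k0] [CommRing k]
    [IsDomain k] (ev : A →+* k0) (j : k0 →+* k) (φ : integralClosure A L →+* k)
    (hj : j.comp ev = φ.comp (algebraMap A (integralClosure A L))) (H : A[X]) (hH : H.Monic)
    (n : ℕ) (hn : H.natDegree = n) (hs : (H.map (algebraMap A L)).Splits) (a : Fin n → k0)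
    (ha : Function.Injective a) (hr : ∀ i, (H.map ev).eval (a i) = 0) :
    ∃ r : Fin n → integralClosure A L, (∀ i, φ (r i) = j (a i)) ∧
      Function.Injective r ∧
      ∀ z : L, (H.map (algebraMap A L)).IsRoot z ↔ ∃ i, (r i : L) = z := by
  classical
  obtain ⟨rs, hrs, hroot⟩ := lift_roots H hH hs
  have hprod : (H.map ev).map j = ((rs.map φ).map (fun r => X - C r)).prod := by
    rw [Polynomial.map_map, hj, ← Polynomial.map_map, hrs, Polynomial.map_multiset_prod,
      Multiset.map_map, Multiset.map_map]
    congr 1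
    apply Multiset.map_congr rfl
    intro r _
    simp
  have hroots : ((H.map ev).map j).roots = rs.map φ := by
    rw [hprod, roots_multiset_prod_X_sub_C]
  have hex : ∀ i, ∃ r ∈ rs, φ r = j (a i) := by
    intro i
    have : j (a i) ∈ rs.map φ := by
      rw [← hroots, mem_roots ((hH.map _).map _).ne_zero, IsRoot, eval_map, eval₂_at_apply, hr i,
        map_zero]
    exact Multiset.mem_map.1 this
  choose r hrm hφ using hex
  have hinj : Function.Injective r := by
    intro i i' h
    apply ha
    apply j.injective
    rw [← hφ, ← hφ, h]
  have hcard : rs.card = n := by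
    have h1 : Nontrivial A := ev.domain_nontrivial
    have h2 := congrArg natDegree hrs
    rw [hH.natDegree_map, hn, natDegree_multiset_prod_X_sub_C_eq_card] at h2
    exact h2.symm
  have hle : (Finset.univ.image r) = rs.toFinset := by
    apply Finset.eq_of_subset_of_card_le
    · intro x hx
      obtain ⟨i, -, rfl⟩ := Finset.mem_image.1 hx
      exact Multiset.mem_toFinset.2 (hrm i)
    · rw [Finset.card_image_of_injective _ hinj, Finset.card_univ, Fintype.card_fin]
      exact (Multiset.toFinset_card_le rs).trans hcard.le
  refine ⟨r, hφ, hinj, fun z => ⟨fun hz => ?_, ?_⟩⟩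
  · obtain ⟨s, hs, rfl⟩ := hroot z hz
    have : s ∈ Finset.univ.image r := by rw [hle]; exact Multiset.mem_toFinset.2 hs
    obtain ⟨i, -, rfl⟩ := Finset.mem_image.1 this
    exact ⟨i, rfl⟩
  · rintro ⟨i, rfl⟩
    rw [IsScalarTower.algebraMap_eq A (integralClosure A L) L, ← Polynomial.map_map, hrs]
    change eval (algebraMap (integralClosure A L) L (r i)) _ = 0
    rw [eval_map_algebraMap, aeval_algebraMap_apply]
    rw [Polynomial.coe_aeval_eq_eval, eval_multiset_prod]
    rw [Multiset.prod_eq_zero, map_zero]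
    rw [Multiset.map_map]
    exact Multiset.mem_map.2 ⟨r i, hrm i, by simp⟩

lemma residue {A L k0 : Type*} [CommRing A] [Field L] [Algebra A L] [FaithfulSMul A L] [Field k0]
    (ev : A →+* k0) (hev : Function.Surjective ev) :
    ∃ (Q : Ideal (integralClosure A L)) (_ : Q.IsMaximal) (j : k0 →+* integralClosure A L ⧸ Q),
      j.comp ev = (Ideal.Quotient.mk Q).comp (algebraMap A (integralClosure A L)) := by
  let S := integralClosure A L
  let P : Ideal A := RingHom.ker ev
  have hPm : P.IsMaximal := RingHom.ker_isMaximal_of_surjective ev hev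
  have hfs : FaithfulSMul A S := by
    rw [faithfulSMul_iff_algebraMap_injective]
    have h := FaithfulSMul.algebraMap_injective A L
    rw [IsScalarTower.algebraMap_eq A S L, RingHom.coe_comp] at h
    exact Function.Injective.of_comp h
  obtain ⟨Q, hQm, hQP⟩ := Ideal.exists_maximal_ideal_liesOver_of_isIntegral P (S := S)
  let e : A ⧸ P ≃+* k0 := RingHom.quotientKerEquivOfSurjective hev
  refine ⟨Q, hQm, (algebraMap (A ⧸ P) (S ⧸ Q)).comp e.symm.toRingHom, ?_⟩
  ext a
  have : e.symm (ev a) = Ideal.Quotient.mk P a := by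
    rw [RingEquiv.symm_apply_eq]
    exact (RingHom.quotientKerEquivOfSurjective_apply_mk hev a).symm
  change algebraMap (A ⧸ P) (S ⧸ Q) (e.symm (ev a)) = _
  rw [this]
  rfl

universe u in
lemma residue_fld {A k0 : Type*} {L : Type u} [CommRing A] [Field L] [Algebra A L]
    [FaithfulSMul A L] [Field k0] (ev : A →+* k0) (hev : Function.Surjective ev) :
    ∃ (k : Type u) (_ : Field k) (φ : integralClosure A L →+* k) (j : k0 →+* k),
      j.comp ev = φ.comp (algebraMap A (integralClosure A L)) := by
  obtain ⟨Q, hQ, j, hj⟩ := residue (L := L) ev hev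
  exact ⟨_, Ideal.Quotient.field Q, Ideal.Quotient.mk Q, j, hj⟩

lemma permhom {G T : Type*} [Group G] [MulAction G T] {n : ℕ} (r : Fin n → T)
    (hi : Function.Injective r) (hst : ∀ (g : G) i, ∃ j, r j = g • r i) :
    ∃ π : G →* Equiv.Perm (Fin n), ∀ g i, r (π g i) = g • r i := by
  choose s hs using hst
  let act : MulAction G (Fin n) :=
    { smul := s
      one_smul := fun i => hi ((hs 1 i).trans (one_smul G _))
      mul_smul := fun g h i => hi (by
        change r (s (g * h) i) = r (s g (s h i))
        rw [hs, hs, hs, mul_smul]) }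
  exact ⟨MulAction.toPermHom G (Fin n), fun g i => hs g i⟩

lemma grp_fin {G H : Type*} [Group G] [Group H] (ρ : G →* H) (hρ : Function.Surjective ρ)
    (Θ : G →* MM) (hk : ∀ g, Θ g = 1 ↔ ρ g = 1) (hd : 1320 ∣ Nat.card H) :
    IsSimpleGroup H ∧ Nat.card H = 7920 := by
  have hker : ρ.ker = Θ.ker := by
    ext g; rw [MonoidHom.mem_ker, MonoidHom.mem_ker, hk]
  have e1 : G ⧸ ρ.ker ≃* H := QuotientGroup.quotientKerEquivOfSurjective ρ hρ
  have e2 : G ⧸ ρ.ker ≃* Θ.range :=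
    (QuotientGroup.quotientMulEquivOfEq hker).trans (QuotientGroup.quotientKerEquivRange Θ)
  have e3 : H ≃* Θ.range := e1.symm.trans e2
  have htop : Θ.range = ⊤ := by
    apply eq_top_of_dvd
    rwa [← Nat.card_congr e3.toEquiv]
  have e4 : H ≃* MM := e3.trans ((MulEquiv.subgroupCongr htop).trans Subgroup.topEquiv)
  have := simple_MM
  refine ⟨?_, ?_⟩
  · have : Nontrivial H := e4.toEquiv.nontrivial
    exact IsSimpleGroup.isSimpleGroup_of_surjective e4.symm.toMonoidHom e4.symm.surjective
  · rw [Nat.card_congr e4.toEquiv, card_MM]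

lemma rel_iff {S k Ω : Type*} [CommRing S] [CommRing k] [IsDomain k] [Field Ω] [CharZero Ω]
    (φ : S →+* k) (ι : S →+* Ω) (hι : Function.Injective ι) (h2 : (2 : k) ≠ 0) (D p q p' q' : S)
    (h : ι (D * p ^ 2) = ι (q ^ 2)) (h' : ι (D * p' ^ 2) = ι (q' ^ 2))
    (hp : φ p ≠ 0) (hq : φ q' ≠ 0) :
    ι p * ι q' = ι p' * ι q ↔ φ p * φ q' = φ p' * φ q := by
  constructor
  · intro e
    rw [← map_mul, ← map_mul] at e
    rw [← map_mul, ← map_mul, hι e]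
  · intro e
    rw [map_mul, map_pow, map_pow] at h h'
    have hs : (ι p * ι q' - ι p' * ι q) * (ι p * ι q' + ι p' * ι q) = 0 := by
      linear_combination ι p' ^ 2 * h - ι p ^ 2 * h'
    rcases mul_eq_zero.1 hs with h3 | h3
    · exact sub_eq_zero.1 h3
    · exfalso
      rw [← map_mul, ← map_mul, ← map_add, ← map_zero ι] at h3
      have h4 := congrArg φ (hι h3)
      rw [map_add, map_mul, map_mul, ← e, map_zero, ← two_mul] at h4
      exact mul_ne_zero h2 (mul_ne_zero hp hq) h4

lemma two_ne : (2 : ZMod 487) ≠ 0 := by decide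

/-- The labelling data. -/
lemma labels (Ω : Type*) [Field Ω] [Algebra (RatFunc ℚ) Ω] [Algebra ℤ[X] Ω]
    [IsScalarTower ℤ[X] (RatFunc ℚ) Ω] [IsAlgClosed Ω] :
    ∃ (y : Fin 12 → Ω) (K : Fin 11 → Ω), Function.Injective y ∧ Function.Injective K ∧
      (∀ z, (Fb (algebraMap (RatFunc ℚ) Ω t)).IsRoot z ↔ ∃ i, y i = z) ∧
      (∀ z, (Mp (algebraMap (RatFunc ℚ) Ω t)).IsRoot z ↔ ∃ b, K b = z) ∧
      ∀ b i j, pf (algebraMap (RatFunc ℚ) Ω t) (K b) (y i) * qf (algebraMap (RatFunc ℚ) Ω t) (K b) (y j)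
        = pf (algebraMap (RatFunc ℚ) Ω t) (K b) (y j) * qf (algebraMap (RatFunc ℚ) Ω t) (K b) (y i) ↔
        sm b i j = true := by
  have h487 : Fact (Nat.Prime 487) := ⟨by norm_num⟩
  have hc0 : CharZero Ω := charZero_of_injective_algebraMap (algebraMap (RatFunc ℚ) Ω).injective
  have hff : FaithfulSMul ℤ[X] Ω := by
    rw [faithfulSMul_iff_algebraMap_injective, IsScalarTower.algebraMap_eq ℤ[X] (RatFunc ℚ) Ω]
    exact (algebraMap (RatFunc ℚ) Ω).injective.comp (IsFractionRing.injective _ _)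
  let ev : ℤ[X] →+* ZMod 487 := eval₂RingHom (Int.castRingHom (ZMod 487)) 336
  have hev : Function.Surjective ev := by
    intro x
    obtain ⟨k, rfl⟩ := ZMod.intCast_surjective x
    exact ⟨C k, by simp [ev]⟩
  have hevX : ev X = 336 := by simp [ev]
  obtain ⟨k, hk, φ, j, hj⟩ := residue_fld (L := Ω) ev hev
  have hm1 := mapZ (L := Ω)
  have hm2 : (Mp (X : ℤ[X])).map (algebraMap ℤ[X] Ω) = Mp (algebraMap (RatFunc ℚ) Ω t) := by
    rw [Mp_map, IsScalarTower.algebraMap_apply ℤ[X] (RatFunc ℚ) Ω, algZ_X]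
  obtain ⟨y, hy1, hy2, hy3⟩ := lab (L := Ω) ev j φ hj (Fb X) (Fb_monic _) 12 (Fb_deg _)
    (IsAlgClosed.splits _) yb yb_inj (by
      intro i
      rw [Fb_map, hevX, Fb_eval]; exact yb_root i)
  obtain ⟨K, hK1, hK2, hK3⟩ := lab (L := Ω) ev j φ hj (Mp X) (Mp_monic _) 11 (Mp_deg _)
    (IsAlgClosed.splits _) kb kb_inj (by
      intro i
      rw [Mp_map, hevX, Mp_eval]; exact kb_root i)
  rw [hm1] at hy3
  rw [hm2] at hK3
  have hyr : ∀ i, (Fb (algebraMap (RatFunc ℚ) Ω t)).eval (y i : Ω) = 0 := fun i => (hy3 _).2 ⟨i, rfl⟩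
  have hKr : ∀ b, (Mp (algebraMap (RatFunc ℚ) Ω t)).eval (K b : Ω) = 0 := fun i => (hK3 _).2 ⟨i, rfl⟩
  let S := integralClosure ℤ[X] Ω
  let ι : S →+* Ω := algebraMap S Ω
  have hι : Function.Injective ι := Subtype.val_injective
  let T : S := algebraMap ℤ[X] S X
  have hιT : ι T = algebraMap (RatFunc ℚ) Ω t := by
    rw [← algZ_X, ← IsScalarTower.algebraMap_apply ℤ[X] (RatFunc ℚ) Ω]; rfl
  have hφT : φ T = j 336 := by
    rw [← hevX]; exact (RingHom.congr_fun hj X).symm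
  have hιy : ∀ i, ι (y i) = (y i : Ω) := fun i => rfl
  have hιK : ∀ i, ι (K i) = (K i : Ω) := fun i => rfl
  have hφy : ∀ i, φ (y i) = j (yb i) := hy1
  have hφK : ∀ i, φ (K i) = j (kb i) := hK1
  have hz : ∀ (b : Fin 11) (l : List ℤ), lz (kb b) l ≠ 0 → lz (K b : Ω) l ≠ 0 := by
    intro b l h0 h1
    rw [← hιK, ← lz_map ι, ← map_zero ι] at h1
    have h2 := congrArg φ (hι h1)
    rw [lz_map φ, hφK, ← lz_map j, map_zero, ← map_zero j] at h2
    exact h0 (j.injective h2)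
  have hsq : ∀ b i, ι (lz (K b) cD * pf T (K b) (y i) ^ 2) = ι (qf T (K b) (y i) ^ 2) := by
    intro b i
    rw [map_mul, map_pow, map_pow, lz_map ι, pf_map ι, qf_map ι, hιT, hιy, hιK]
    exact main_sq _ _ _ (hKr b) (hyr i) (hz b _ (kb_ne b).1) (hz b _ (kb_ne b).2)
  have hp0 : ∀ b i, φ (pf T (K b) (y i)) = j (pf 336 (kb b) (yb i)) := by
    intro b i
    rw [pf_map φ, pf_map j, hφT, hφK, hφy]
  have hq0 : ∀ b i, φ (qf T (K b) (y i)) = j (qf 336 (kb b) (yb i)) := by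
    intro b i
    rw [qf_map φ, qf_map j, hφT, hφK, hφy]
  have h2 : (2 : k) ≠ 0 := by
    have h : j 2 = 2 := map_ofNat j 2
    rw [← h, map_ne_zero_iff j j.injective]
    exact two_ne
  refine ⟨fun i => y i, fun b => K b, Subtype.val_injective.comp hy2, Subtype.val_injective.comp hK2,
    hy3, hK3, ?_⟩
  intro b i i'
  have h := rel_iff φ ι hι h2 (lz (K b) cD) (pf T (K b) (y i)) (qf T (K b) (y i))
    (pf T (K b) (y i')) (qf T (K b) (y i')) (hsq b i) (hsq b i')
    (by rw [hp0, map_ne_zero_iff j j.injective]; exact (pq_ne b i).1)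
    (by rw [hq0, map_ne_zero_iff j j.injective]; exact (pq_ne b i').2)
  rw [hp0, hp0, hq0, hq0, pf_map ι, pf_map ι, qf_map ι, qf_map ι, hιT, hιy, hιy, hιK, ← map_mul,
    ← map_mul, j.injective.eq_iff, sm_tab] at h
  exact h

lemma m11_abs (Ω : Type*) [Field Ω] [Algebra (RatFunc ℚ) Ω] [Algebra ℤ[X] Ω]
    [IsScalarTower ℤ[X] (RatFunc ℚ) Ω] [IsAlgClosed Ω] [Normal (RatFunc ℚ) Ω] :
    IsSimpleGroup f.Gal ∧ Nat.card f.Gal = 7920 := by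
  obtain ⟨y, K, hyi, hKi, hy, hK, hsm⟩ := labels Ω
  have hc0 : CharZero Ω := charZero_of_injective_algebraMap (algebraMap (RatFunc ℚ) Ω).injective
  set T := algebraMap (RatFunc ℚ) Ω t with hT
  let G := Ω ≃ₐ[RatFunc ℚ] Ω
  have hgT : ∀ g : G, g T = T := fun g => g.commutes t
  have hgF : ∀ (g : G) (z : Ω), (Fb T).IsRoot z → (Fb T).IsRoot (g z) := by
    intro g z hz
    have h := Polynomial.eval₂_at_apply (p := Fb T) (g : Ω →+* Ω) z
    rw [← eval_map, Fb_map] at h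
    rw [IsRoot] at hz ⊢
    rw [hz, map_zero] at h
    change eval (g z) (Fb (g T)) = 0 at h
    rwa [hgT] at h
  have hgM : ∀ (g : G) (z : Ω), (Mp T).IsRoot z → (Mp T).IsRoot (g z) := by
    intro g z hz
    have h := Polynomial.eval₂_at_apply (p := Mp T) (g : Ω →+* Ω) z
    rw [← eval_map, Mp_map] at h
    rw [IsRoot] at hz ⊢
    rw [hz, map_zero] at h
    change eval (g z) (Mp (g T)) = 0 at h
    rwa [hgT] at h
  obtain ⟨π, hπ⟩ := permhom (G := G) y hyi (fun g i => (hy _).1 (hgF g _ ((hy _).2 ⟨i, rfl⟩)))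
  obtain ⟨κ, hκ⟩ := permhom (G := G) K hKi (fun g i => (hK _).1 (hgM g _ ((hK _).2 ⟨i, rfl⟩)))
  have hπ' : ∀ (g : G) i, y (π g i) = g (y i) := hπ
  have hκ' : ∀ (g : G) i, K (κ g i) = g (K i) := hκ
  have hmem : ∀ g : G, (π.prod κ) g ∈ MM := by
    intro g
    rw [mem_MM]
    intro b i j
    rw [Bool.eq_iff_iff]
    change sm (κ g b) (π g i) (π g j) = true ↔ _
    rw [← hsm, ← hsm, hπ', hπ', hκ']
    have e1 : ∀ i, pf T (g (K b)) (g (y i)) = g (pf T (K b) (y i)) := by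
      intro i; rw [pf_map g, hgT]
    have e2 : ∀ i, qf T (g (K b)) (g (y i)) = g (qf T (K b) (y i)) := by
      intro i; rw [qf_map g, hgT]
    rw [e1, e1, e2, e2, ← map_mul, ← map_mul, g.injective.eq_iff]
  let Θ : G →* MM := (π.prod κ).codRestrict MM hmem
  have hsp : Fact ((f.map (algebraMap (RatFunc ℚ) Ω)).Splits) := ⟨IsAlgClosed.splits _⟩
  have hroot : ∀ x : Ω, x ∈ f.rootSet Ω ↔ ∃ i, y i = 4 * x := by
    intro x
    rw [← hy, ← root_iff, mem_rootSet, IsRoot, eval_map_algebraMap]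
    simp [f_ne]
  refine grp_fin (Gal.restrict f Ω) (Gal.restrict_surjective f Ω) Θ ?_ card_dvd
  intro g
  have hA : Gal.restrict f Ω g = 1 ↔ ∀ x ∈ f.rootSet Ω, g x = x := by
    rw [← map_eq_one_iff (Gal.galActionHom f Ω) (Gal.galActionHom_injective f Ω)]
    constructor
    · intro h x hx
      have h1 := Equiv.congr_fun h ⟨x, hx⟩
      have h2 := Gal.restrict_smul (p := f) (E := Ω) g ⟨x, hx⟩
      rw [← h2]
      exact congrArg Subtype.val h1
    · intro h
      ext x
      have h2 := Gal.restrict_smul (p := f) (E := Ω) g x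
      exact h2.trans (h x x.2)
  rw [hA]
  constructor
  · intro h x hx
    have h1 : π g = 1 := congrArg (fun z : MM => z.1.1) h
    obtain ⟨i, hi⟩ := (hroot x).1 hx
    have h2 := hπ' g i
    rw [h1, hi, map_mul, map_ofNat] at h2
    rw [Equiv.Perm.one_apply, hi] at h2
    exact (mul_left_cancel₀ (by norm_num) h2).symm
  · intro h
    have h1 : π g = 1 := by
      ext i : 1
      apply hyi
      rw [hπ', Equiv.Perm.one_apply]
      have h4 : (4 : Ω) ≠ 0 := by norm_num
      have h2 := h (y i / 4) ((hroot _).2 ⟨i, by field_simp⟩)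
      rw [map_div₀, map_ofNat] at h2
      field_simp at h2
      exact h2
    have h2 : κ g = 1 := by
      ext b : 1
      apply sm_inj
      intro i
      have := (mem_MM _).1 (hmem g) b 0 i
      change sm (κ g b) (π g 0) (π g i) = _ at this
      rw [h1] at this
      exact this
    apply Subtype.ext
    exact Prod.ext h1 h2

theorem m11_small : f.natDegree = 12 ∧ IsSimpleGroup f.Gal ∧ Nat.card f.Gal = 7920 :=
  ⟨f_deg, m11_abs (AlgebraicClosure (RatFunc ℚ))⟩
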